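/- (Scattering) Let $1<\gamma<\infty$ and let $F$ be a power-like nonlinearity of degree $\gamma$ satisfying the gauge invariance condition $\mathrm{Im}\,(F(u)\overline{u})=0$. For any $f\in L^2(\mathbb{T})$, let $u$ be the unique global solution of $u(t)=e^{it\mathcal{L}}f-i\int_0^t e^{i(t-s)\mathcal{L}}F(u(s))\,ds$ belonging to $C(\mathbb{R};L^2(\mathbb{T}))\cap L^{p}(\mathbb{R};L^{q}(\mathbb{T}))$ for suitable admissible exponents $p\in(2,\infty)$, $q\in(2,\infty)$. Then $u$ scatters: there exist $u_+,u_-\in L^2(\mathbb{T})$ such that $\|u(t)-e^{it\mathcal{L}}u_{\pm}\|_{L^2(\mathbb{T})}\to0$ as $t\to\pm\infty$. -/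

import Mathlib

noncomputable section

open Complex MeasureTheory Filter
open scoped ENNReal NNReal Topology

/-- A homogeneous tree of degree `Q+1`: a connected acyclic graph in which every
vertex has exactly `Q+1` neighbours. -/
structure HomTree (Q : ℕ) : Type 1 where
  V : Type
  graph : SimpleGraph V
  isTree : graph.IsTree
  regular : ∀ x : V, {y : V | graph.Adj x y}.ncard = Q + 1

/-- `γ(0) = 2/(Q^{1/2} + Q^{-1/2})`. -/
def gammaZero (Q : ℕ) : ℝ := 2 / (Real.sqrt Q + (Real.sqrt Q)⁻¹)

/-- The radial Schrödinger kernel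
`s_t(n) = e^{it} (2/π) ∑_{k≥0} Q^{-n/2-k} ∫₀^π e^{-iγ(0)t cos λ} sin λ sin((n+2k+1)λ) dλ`. -/
def schKernel (Q : ℕ) (t : ℝ) (n : ℕ) : ℂ :=
  Complex.exp (Complex.I * t) * (2 / Real.pi) *
    ∑' k : ℕ, (((Q : ℝ) ^ (-(n : ℝ) / 2 - (k : ℝ)) : ℝ) : ℂ) *
      ∫ l in (0 : ℝ)..Real.pi,
        Complex.exp (-Complex.I * (gammaZero Q) * t * Real.cos l) *
          (Real.sin l : ℂ) * (Real.sin (((n : ℝ) + 2 * k + 1) * l) : ℂ)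

/-- The sum of `g` over the sphere of radius `n` centred at `x`. -/
def sphereSum {Q : ℕ} (T : HomTree Q) (g : T.V → ℂ) (x : T.V) (n : ℕ) : ℂ :=
  ∑' y : {y : T.V // T.graph.dist x y = n}, g y

/-- The Schrödinger propagator `e^{itℒ}`, realised (and extended to all
`L^p` spaces) as convolution with the radial kernel `s_t`:
`e^{itℒ}g(x) = ∑_{n≥0} s_t(n) ∑_{d(x,y)=n} g(y)`. -/
def propagate {Q : ℕ} (T : HomTree Q) (t : ℝ) (g : T.V → ℂ) (x : T.V) : ℂ :=
  ∑' n : ℕ, schKernel Q t n * sphereSum T g x n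

/-- The `L^q(𝕋)` norm (with the counting measure), valued in `ℝ≥0∞`, for an
exponent `q : ℝ≥0∞`. -/
def spaceNorm {Q : ℕ} (T : HomTree Q) (q : ℝ≥0∞) (g : T.V → ℂ) : ℝ≥0∞ :=
  if q = ∞ then ⨆ x : T.V, (‖g x‖₊ : ℝ≥0∞)
  else (∑' x : T.V, (‖g x‖₊ : ℝ≥0∞) ^ q.toReal) ^ (1 / q.toReal)

/-- The mixed Lebesgue norm `L^p_t L^q_x` over a time set `A ⊆ ℝ`
(with `sup` in time when `p = ∞`), valued in `ℝ≥0∞`. -/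
def mixedNorm {Q : ℕ} (T : HomTree Q) (p q : ℝ≥0∞) (A : Set ℝ)
    (u : ℝ → T.V → ℂ) : ℝ≥0∞ :=
  if p = ∞ then ⨆ t ∈ A, spaceNorm T q (u t)
  else (∫⁻ t in A, (spaceNorm T q (u t)) ^ p.toReal) ^ (1 / p.toReal)

/-- The admissible set `𝒞 = ((0,1/2] × [0,1/2)) ∪ {(0,1/2)}` for the couple
`(1/p, 1/q)`. -/
def admissiblePair (p q : ℝ≥0∞) : Prop :=
  (0 < p⁻¹ ∧ p⁻¹ ≤ 2⁻¹ ∧ q⁻¹ < 2⁻¹) ∨ (p⁻¹ = 0 ∧ q⁻¹ = 2⁻¹)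

/-- A power-like nonlinearity of degree `γ`: `|F(u)| ≤ C|u|^γ` and
`|F(u)-F(v)| ≤ C(|u|^{γ-1} + |v|^{γ-1})|u-v|`. -/
def PowerLike (F : ℂ → ℂ) (γ : ℝ) : Prop :=
  ∃ C : ℝ, 0 < C ∧ (∀ u : ℂ, ‖F u‖ ≤ C * ‖u‖ ^ γ) ∧
    ∀ u v : ℂ, ‖F u - F v‖ ≤ C * (‖u‖ ^ (γ - 1) + ‖v‖ ^ (γ - 1)) * ‖u - v‖

/-- The gauge invariance condition `Im (F(u) ū) = 0`. -/
def GaugeInvariant (F : ℂ → ℂ) : Prop :=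
  ∀ u : ℂ, (F u * (starRingEnd ℂ) u).im = 0

/-- `u` solves the semilinear Schrödinger equation `i∂ₜu + ℒu = F(u)`, `u(0)=f`,
in the Duhamel (integral) form
`u(t) = e^{itℒ}f - i∫₀ᵗ e^{i(t-s)ℒ}F(u(s)) ds`, on the time set `A`. -/
def SolvesNLS {Q : ℕ} (T : HomTree Q) (F : ℂ → ℂ) (f : T.V → ℂ)
    (u : ℝ → T.V → ℂ) (A : Set ℝ) : Prop :=
  ∀ t ∈ A, ∀ x : T.V, u t x = propagate T t f x -
    Complex.I * ∫ s in (0 : ℝ)..t, propagate T (t - s) (fun y => F (u s y)) x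

/-- `u : A → L²(𝕋)` is continuous in the `L²` norm. -/
def ContL2On {Q : ℕ} (T : HomTree Q) (u : ℝ → T.V → ℂ) (A : Set ℝ) : Prop :=
  ∀ t₀ ∈ A, Filter.Tendsto (fun t => spaceNorm T 2 (fun x => u t x - u t₀ x))
    (nhdsWithin t₀ A) (nhds 0)

/-- The norm of the space `X = C(A; L²(𝕋)) ∩ L^p(A; L^q(𝕋))`. -/
def Xnorm {Q : ℕ} (T : HomTree Q) (p q : ℝ≥0∞) (A : Set ℝ)
    (u : ℝ → T.V → ℂ) : ℝ≥0∞ :=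
  (⨆ t ∈ A, spaceNorm T 2 (u t)) + mixedNorm T p q A u

section Hilbert

variable {E : Type*} [NormedAddCommGroup E] [InnerProductSpace ℂ E] [CompleteSpace E]

lemma young_weighted {k n : ℝ → ℝ} (hk : Continuous k) (hk0 : ∀ t, 0 ≤ k t)
    (hke : ∀ t, k (-t) = k t) (hki : Integrable k) (hn : Continuous n)
    {a b : ℝ} (hab : a ≤ b) :
    ∫ t in a..b, ∫ s in a..b, k (t - s) * n s * n t ≤ (∫ t, k t) * ∫ t in a..b, n t ^ 2 := by
  have hsub : ∀ t, ∫ s in a..b, k (t - s) ≤ ∫ s, k s := by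
    intro t
    rw [intervalIntegral.integral_comp_sub_left (fun s => k s),
      intervalIntegral.integral_of_le (by linarith)]
    exact setIntegral_le_integral hki (Eventually.of_forall hk0)
  have hright : ∫ t in a..b, ∫ s in a..b, k (t - s) * n t ^ 2
      ≤ (∫ t, k t) * ∫ t in a..b, n t ^ 2 := by
    rw [← intervalIntegral.integral_const_mul]
    refine intervalIntegral.integral_mono_on hab ?_ ?_ fun t _ => ?_
    · exact Continuous.intervalIntegrable
        (intervalIntegral.continuous_parametric_intervalIntegral_of_continuous' (by fun_prop) _ _)
        _ _
    · exact Continuous.intervalIntegrable (by fun_prop) _ _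
    · rw [intervalIntegral.integral_mul_const]
      exact mul_le_mul_of_nonneg_right (hsub t) (sq_nonneg _)
  have hleft : ∫ t in a..b, ∫ s in a..b, k (t - s) * n s ^ 2
      = ∫ t in a..b, ∫ s in a..b, k (t - s) * n t ^ 2 := by
    rw [intervalIntegral_intervalIntegral_swap]
    · refine intervalIntegral.integral_congr fun t _ => intervalIntegral.integral_congr fun s _ => ?_
      rw [← hke, neg_sub]
    · refine IntegrableOn.mono_set (t := Set.Icc a b ×ˢ Set.Icc a b) ?_ ?_
      · refine ContinuousOn.integrableOn_compact (isCompact_Icc.prod isCompact_Icc) ?_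
        exact Continuous.continuousOn (by fun_prop)
      · rw [Set.uIoc_of_le hab]
        exact Set.prod_mono Set.Ioc_subset_Icc_self Set.Ioc_subset_Icc_self
  have hsplit : ∫ t in a..b, ∫ s in a..b, k (t - s) * n s * n t
      ≤ ∫ t in a..b, ((1 / 2) * (∫ s in a..b, k (t - s) * n s ^ 2)
        + (1 / 2) * ∫ s in a..b, k (t - s) * n t ^ 2) := by
    refine intervalIntegral.integral_mono_on hab ?_ ?_ fun t _ => ?_
    · exact Continuous.intervalIntegrable
        (intervalIntegral.continuous_parametric_intervalIntegral_of_continuous' (by fun_prop) _ _)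
        _ _
    · refine Continuous.intervalIntegrable (Continuous.add (continuous_const.mul ?_)
        (continuous_const.mul ?_)) _ _
      all_goals
        exact intervalIntegral.continuous_parametric_intervalIntegral_of_continuous'
          (by fun_prop) _ _
    · rw [← intervalIntegral.integral_const_mul, ← intervalIntegral.integral_const_mul,
        ← intervalIntegral.integral_add]
      · refine intervalIntegral.integral_mono_on hab ?_ ?_ fun s _ => ?_
        · exact Continuous.intervalIntegrable (by fun_prop) _ _
        · exact Continuous.intervalIntegrable (by fun_prop) _ _
        · nlinarith [mul_nonneg (hk0 (t - s)) (sq_nonneg (n s - n t))]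
      · exact Continuous.intervalIntegrable (by fun_prop) _ _
      · exact Continuous.intervalIntegrable (by fun_prop) _ _
  refine hsplit.trans ?_
  rw [intervalIntegral.integral_add, intervalIntegral.integral_const_mul,
    intervalIntegral.integral_const_mul, hleft]
  · linarith
  all_goals
    refine Continuous.intervalIntegrable (continuous_const.mul ?_) _ _
    exact intervalIntegral.continuous_parametric_intervalIntegral_of_continuous' (by fun_prop) _ _

lemma intervalIntegral_inner_right {g : ℝ → E} (hg : Continuous g) (y : E) (a b : ℝ) :
    ∫ s in a..b, inner ℂ y (g s) = inner ℂ y (∫ s in a..b, g s) :=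
  (innerSL ℂ y).intervalIntegral_comp_comm (hg.intervalIntegrable _ _)

lemma norm_inner_integral_le {k n : ℝ → ℝ} (hk : Continuous k) (hk0 : ∀ t, 0 ≤ k t)
    (hn : Continuous n) (hn0 : ∀ t, 0 ≤ n t)
    {g : ℝ → E} (hg : Continuous g) {y : E} {t : ℝ}
    (h : ∀ s, ‖inner ℂ (g s) y‖ ≤ k (t - s) * n s * n t)
    {a b e : ℝ} (hae : a ≤ e) (heb : e ≤ b) :
    ‖inner ℂ (∫ s in a..e, g s) y‖ ≤ ∫ s in a..b, k (t - s) * n s * n t := by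
  rw [norm_inner_symm, ← intervalIntegral_inner_right hg]
  have hc : Continuous fun s => k (t - s) * n s * n t := by fun_prop
  calc ‖∫ s in a..e, inner ℂ y (g s)‖
      ≤ ∫ s in a..e, k (t - s) * n s * n t :=
        intervalIntegral.norm_integral_le_of_norm_le hae
          (Eventually.of_forall fun s _ => by rw [norm_inner_symm]; exact h s)
          (hc.intervalIntegrable _ _)
    _ ≤ ∫ s in a..b, k (t - s) * n s * n t :=
        intervalIntegral.integral_mono_interval le_rfl hae heb
          (Eventually.of_forall fun s => mul_nonneg (mul_nonneg (hk0 _) (hn0 _)) (hn0 _))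
          (hc.intervalIntegrable _ _)

lemma norm_integral_inner_le {k n : ℝ → ℝ} (hk : Continuous k) (hk0 : ∀ t, 0 ≤ k t)
    (hke : ∀ t, k (-t) = k t) (hki : Integrable k) (hn : Continuous n) (hn0 : ∀ t, 0 ≤ n t)
    {g w : ℝ → E} (hg : Continuous g)
    (h : ∀ s t, ‖inner ℂ (g s) (w t)‖ ≤ k (t - s) * n s * n t)
    {a b : ℝ} (hab : a ≤ b) (e : ℝ → ℝ) (he : ∀ t ∈ Set.Icc a b, a ≤ e t ∧ e t ≤ b) :
    ‖∫ t in a..b, inner ℂ (∫ s in a..e t, g s) (w t)‖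
      ≤ (∫ t, k t) * ∫ t in a..b, n t ^ 2 := by
  refine le_trans ?_ (young_weighted hk hk0 hke hki hn hab)
  refine intervalIntegral.norm_integral_le_of_norm_le hab
    (Eventually.of_forall fun t ht => ?_) ?_
  · have := he t ⟨ht.1.le, ht.2⟩
    exact norm_inner_integral_le hk hk0 hn hn0 hg (fun s => h s t) this.1 this.2
  · exact Continuous.intervalIntegrable
      (intervalIntegral.continuous_parametric_intervalIntegral_of_continuous' (by fun_prop) _ _)
      _ _

lemma norm_integral_sq_le {k n : ℝ → ℝ} (hk : Continuous k) (hk0 : ∀ t, 0 ≤ k t)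
    (hke : ∀ t, k (-t) = k t) (hki : Integrable k) (hn : Continuous n) (hn0 : ∀ t, 0 ≤ n t)
    {g : ℝ → E} (hg : Continuous g)
    (h : ∀ s t, ‖inner ℂ (g s) (g t)‖ ≤ k (t - s) * n s * n t)
    {a b : ℝ} (hab : a ≤ b) :
    ‖∫ t in a..b, g t‖ ^ 2 ≤ (∫ t, k t) * ∫ t in a..b, n t ^ 2 := by
  have := norm_integral_inner_le hk hk0 hke hki hn hn0 hg h hab (fun _ => b)
    (fun t _ => ⟨hab, le_rfl⟩)
  rwa [intervalIntegral_inner_right hg, inner_self_eq_norm_sq_to_K, norm_pow,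
    RCLike.norm_ofReal, abs_of_nonneg (norm_nonneg _)] at this

/-- Abstract Strichartz bootstrap: if the forcing `g` and the test curve `w` satisfy `TT*` bounds
with an integrable kernel, and `⟪v, w⟫` eventually dominates the square of the weight `n`, then
the bounded curve `v` converges. -/
lemma exists_tendsto_of_bootstrap {k n Φ : ℝ → ℝ} (hk : Continuous k) (hk0 : ∀ t, 0 ≤ k t)
    (hke : ∀ t, k (-t) = k t) (hki : Integrable k) (hn : Continuous n) (hn0 : ∀ t, 0 ≤ n t)
    {v g w : ℝ → E} (hv : Continuous v) (hg : Continuous g) (hw : Continuous w)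
    (hvg : ∀ s t, v t - v s = ∫ r in s..t, g r)
    (hgg : ∀ s t, ‖inner ℂ (g s) (g t)‖ ≤ k (t - s) * n s * n t)
    (hgw : ∀ s t, ‖inner ℂ (g s) (w t)‖ ≤ k (t - s) * n s * n t)
    (hww : ∀ s t, ‖inner ℂ (w s) (w t)‖ ≤ k (t - s) * n s * n t)
    (hΦ : ∀ t, inner ℂ (v t) (w t) = (Φ t : ℂ)) {M : ℝ} (hM : ∀ t, ‖v t‖ ≤ M)
    (hsmall : ∀ ε > 0, ∃ T, ∀ t ≥ T, n t ^ 2 ≤ ε * Φ t) :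
    ∃ vplus : E, Tendsto v atTop (𝓝 vplus) := by
  set K : ℝ := (∫ t, k t) + 1 with hKdef
  have hK0 : 0 ≤ ∫ t, k t := integral_nonneg hk0
  have hK : 0 < K := by linarith
  have hM0 : 0 ≤ M := (norm_nonneg _).trans (hM 0)
  obtain ⟨T, hT⟩ := hsmall (1 / (2 * K)) (by positivity)
  have hΦc : Continuous Φ := by
    have : Φ = fun t => (inner ℂ (v t) (w t) : ℂ).re := by
      ext t; rw [hΦ]; simp
    rw [this]
    exact Complex.continuous_re.comp (hv.inner hw)
  have hnn : ∀ a b : ℝ, a ≤ b → 0 ≤ ∫ t in a..b, n t ^ 2 := fun a b hab =>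
    intervalIntegral.integral_nonneg hab fun _ _ => sq_nonneg _
  have hle : ∀ a b : ℝ, a ≤ b → (∫ t, k t) * ∫ t in a..b, n t ^ 2 ≤ K * ∫ t in a..b, n t ^ 2 :=
    fun a b hab => mul_le_mul_of_nonneg_right (by linarith) (hnn a b hab)
  have hbound : ∀ b, T ≤ b → K * ∫ t in T..b, n t ^ 2 ≤ M ^ 2 := by
    intro b hb
    set Y := K * ∫ t in T..b, n t ^ 2 with hY
    set X := ∫ t in T..b, Φ t with hX
    have hY0 : 0 ≤ Y := mul_nonneg hK.le (hnn _ _ hb)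
    have hYX : Y ≤ X / 2 := by
      have h1 : ∫ t in T..b, n t ^ 2 ≤ ∫ t in T..b, 1 / (2 * K) * Φ t :=
        intervalIntegral.integral_mono_on hb (Continuous.intervalIntegrable (by fun_prop) _ _)
          (Continuous.intervalIntegrable (by fun_prop) _ _) fun t ht => hT t ht.1
      rw [intervalIntegral.integral_const_mul] at h1
      calc Y ≤ K * (1 / (2 * K) * X) := mul_le_mul_of_nonneg_left h1 hK.le
        _ = X / 2 := by field_simp
    have hXle : X ≤ M * √Y + Y := by
      have hdecomp : (X : ℂ) = inner ℂ (v T) (∫ t in T..b, w t)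
          + ∫ t in T..b, inner ℂ (∫ s in T..t, g s) (w t) := by
        rw [← intervalIntegral_inner_right hw, ← intervalIntegral.integral_add, hX,
          ← intervalIntegral.integral_ofReal]
        · refine intervalIntegral.integral_congr fun t _ => ?_
          rw [← inner_add_left, ← hvg, add_sub_cancel, hΦ]
        · exact Continuous.intervalIntegrable (by fun_prop) _ _
        · refine Continuous.intervalIntegrable (Continuous.inner ?_ hw) _ _
          exact intervalIntegral.continuous_primitive (fun a b => hg.intervalIntegrable a b) _
      have h1 : ‖inner ℂ (v T) (∫ t in T..b, w t)‖ ≤ M * √Y := by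
        refine (norm_inner_le_norm _ _).trans ?_
        gcongr
        · exact hM T
        · exact Real.le_sqrt_of_sq_le ((norm_integral_sq_le hk hk0 hke hki hn hn0 hw hww hb).trans
            (hle _ _ hb))
      have h2 := (norm_integral_inner_le hk hk0 hke hki hn hn0 hg hgw hb (fun t => t)
        (fun t ht => ht)).trans (hle _ _ hb)
      calc X ≤ ‖(X : ℂ)‖ := by rw [Complex.norm_real]; exact le_abs_self X
        _ ≤ _ := by rw [hdecomp]; exact (norm_add_le _ _).trans (add_le_add h1 h2)
    have hs := Real.sq_sqrt hY0
    have hs0 := Real.sqrt_nonneg Y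
    have : √Y ≤ M := by
      by_contra hlt
      push Not at hlt
      nlinarith
    nlinarith
  have hmono : Monotone fun b => ∫ t in T..max T b, n t ^ 2 := by
    intro b c hbc
    exact intervalIntegral.integral_mono_interval le_rfl (le_max_left _ _)
      (max_le_max le_rfl hbc) (Eventually.of_forall fun _ => sq_nonneg _)
      (Continuous.intervalIntegrable (by fun_prop) _ _)
  have hbdd : BddAbove (Set.range fun b => ∫ t in T..max T b, n t ^ 2) := by
    refine ⟨M ^ 2 / K, ?_⟩
    rintro _ ⟨b, rfl⟩
    rw [le_div_iff₀ hK, mul_comm]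
    exact hbound _ (le_max_left _ _)
  have hcauchy := (tendsto_atTop_ciSup hmono hbdd).cauchy_map
  rw [Metric.cauchy_iff] at hcauchy
  refine cauchy_map_iff_exists_tendsto.1 ?_
  rw [Metric.cauchy_iff]
  refine ⟨map_neBot, fun ε hε => ?_⟩
  obtain ⟨s, hs, hsd⟩ := hcauchy.2 (ε ^ 2 / K) (by positivity)
  obtain ⟨B, hB⟩ := mem_atTop_sets.1 (mem_map.1 hs)
  have key : ∀ x y, max T B ≤ x → x ≤ y → dist (v x) (v y) < ε := by
    intro x y hx hxy
    have hTx := (le_max_left T B).trans hx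
    have hBx := (le_max_right T B).trans hx
    have h1 := hsd _ (hB x hBx) _ (hB y (hBx.trans hxy))
    simp only [max_eq_right hTx, max_eq_right (hTx.trans hxy)] at h1
    rw [dist_comm, Real.dist_eq, intervalIntegral.integral_interval_sub_left
      (Continuous.intervalIntegrable (by fun_prop) _ _)
      (Continuous.intervalIntegrable (by fun_prop) _ _), abs_of_nonneg (hnn _ _ hxy)] at h1
    have h2 := (norm_integral_sq_le hk hk0 hke hki hn hn0 hg hgg hxy).trans (hle _ _ hxy)
    rw [← hvg] at h2
    rw [lt_div_iff₀ hK, mul_comm] at h1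
    rw [dist_comm, dist_eq_norm]
    exact lt_of_pow_lt_pow_left₀ 2 hε.le (h2.trans_lt h1)
  refine ⟨v '' Set.Ici (max T B), image_mem_map (Ici_mem_atTop _), ?_⟩
  rintro _ ⟨x, hx, rfl⟩ _ ⟨y, hy, rfl⟩
  rcases le_total x y with h | h
  · exact key x y hx h
  · rw [dist_comm]; exact key y x hy h

end Hilbert

namespace HomTree

variable {Q : ℕ} (T : HomTree Q)

lemma finite_neighbors (x : T.V) : {y : T.V | T.graph.Adj x y}.Finite :=
  Set.finite_of_ncard_ne_zero (by rw [T.regular x]; omega)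

/-- The finite set of neighbours of a vertex. -/
def nbr (x : T.V) : Finset T.V := (T.finite_neighbors x).toFinset

@[simp] lemma mem_nbr {x y : T.V} : y ∈ T.nbr x ↔ T.graph.Adj x y := by simp [nbr]

lemma mem_nbr_comm {x y : T.V} : y ∈ T.nbr x ↔ x ∈ T.nbr y := by simp [T.graph.adj_comm]

lemma card_nbr (x : T.V) : (T.nbr x).card = Q + 1 := by
  rw [← T.regular x, Set.ncard_eq_toFinset_card _ (T.finite_neighbors x), nbr]

lemma dist_eq_one_of_mem_nbr {x z : T.V} (hz : z ∈ T.nbr x) : T.graph.dist z x = 1 := by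
  rw [SimpleGraph.dist_eq_one_iff_adj]
  exact (T.mem_nbr.1 hz).symm

/-- In a tree, exactly one neighbour of `x ≠ y` is closer to `y`. -/
lemma exists_closer {x y : T.V} (hxy : x ≠ y) :
    ∃ z ∈ T.nbr x, T.graph.dist z y + 1 = T.graph.dist x y ∧
      ∀ z' ∈ T.nbr x, z' ≠ z → T.graph.dist z' y = T.graph.dist x y + 1 := by
  classical
  obtain ⟨p, hp, hpl⟩ := T.isTree.connected.exists_path_of_dist x y
  have hnn : ¬ p.Nil := fun h => hxy h.eq
  have hadj : T.graph.Adj x p.snd := p.adj_snd hnn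
  have hlen : p.tail.length + 1 = T.graph.dist x y := by
    rw [← hpl]; exact SimpleGraph.Walk.length_tail_add_one hnn
  have hle : T.graph.dist p.snd y ≤ p.tail.length := SimpleGraph.dist_le _
  have hcases : ∀ z, T.graph.Adj x z → T.graph.dist x y = T.graph.dist z y + 1 ∨
      T.graph.dist z y = T.graph.dist x y + 1 := fun z hz => by
    have := T.isTree.dist_eq_dist_add_one_of_adj y hz
    rwa [T.graph.dist_comm, T.graph.dist_comm (u := y) (v := z)] at this
  refine ⟨p.snd, T.mem_nbr.2 hadj, ?_, fun z hz hne => ?_⟩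
  · rcases hcases _ hadj with h | h <;> omega
  · rw [T.mem_nbr] at hz
    rcases hcases z hz with h | h
    · exfalso
      obtain ⟨q, hq, hql⟩ := T.isTree.connected.exists_path_of_dist z y
      have hxq : x ∉ q.support := by
        intro hx
        have h1 : T.graph.dist x y ≤ (q.dropUntil x hx).length := SimpleGraph.dist_le _
        have h2 := q.length_dropUntil_le_length hx
        omega
      have := T.isTree.isAcyclic.subsingleton_path x y |>.elim ⟨p, hp⟩
        ⟨q.cons hz, hq.cons hxq⟩
      have hpq : p = q.cons hz := Subtype.mk.inj this
      exact hne (by rw [hpq]; simp)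
    · exact h

/-- The neighbour sum of a radial function. -/
lemma sum_nbr_dist {M : Type*} [AddCommMonoid M] (φ : ℕ → M) (x y : T.V) :
    ∑ z ∈ T.nbr x, φ (T.graph.dist z y) =
      if T.graph.dist x y = 0 then (Q + 1) • φ 1
      else φ (T.graph.dist x y - 1) + Q • φ (T.graph.dist x y + 1) := by
  classical
  split_ifs with h
  · have hxy : x = y := (T.isTree.connected.dist_eq_zero_iff).1 h
    subst hxy
    rw [Finset.sum_congr rfl fun z hz => by rw [T.dist_eq_one_of_mem_nbr hz], Finset.sum_const,
      T.card_nbr]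
  · have hxy : x ≠ y := fun e => h (by rw [e]; simp)
    obtain ⟨z, hz, hz1, hz2⟩ := T.exists_closer hxy
    rw [← Finset.add_sum_erase _ _ hz, Finset.sum_congr rfl fun w hw => by
      rw [hz2 w (Finset.mem_of_mem_erase hw) (Finset.ne_of_mem_erase hw)], Finset.sum_const,
      Finset.card_erase_of_mem hz, T.card_nbr, ← hz1]
    simp

/-- The kernel of the Chebyshev polynomial `U_m` evaluated at the normalised adjacency operator,
as a function of the distance. -/
def chebKernel (Q m d : ℕ) : ℝ := if d ≤ m ∧ Even (m + d) then (√Q)⁻¹ ^ m else 0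

lemma chebKernel_nonneg (Q m d : ℕ) : 0 ≤ chebKernel Q m d := by
  unfold chebKernel; split_ifs <;> positivity

lemma chebKernel_le (Q m d : ℕ) : chebKernel Q m d ≤ (√Q)⁻¹ ^ m := by
  unfold chebKernel; split_ifs <;> first | exact le_rfl | positivity

lemma chebKernel_zero (Q d : ℕ) : chebKernel Q 0 d = if d = 0 then 1 else 0 := by
  unfold chebKernel
  rcases Nat.eq_zero_or_pos d with rfl | h
  · simp
  · simp [h.ne']

lemma sum_nbr_chebKernel_zero (hQ : 2 ≤ Q) (x y : T.V) :
    ∑ z ∈ T.nbr x, chebKernel Q 0 (T.graph.dist z y)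
      = √Q * chebKernel Q 1 (T.graph.dist x y) := by
  have hs : √(Q : ℝ) ≠ 0 := by positivity
  rw [T.sum_nbr_dist (chebKernel Q 0)]
  generalize T.graph.dist x y = d
  unfold chebKernel
  rcases d with _ | _ | d
  · simp
  · simp [hs]
  · simp

lemma sum_nbr_chebKernel_succ (hQ : 2 ≤ Q) (m : ℕ) (x y : T.V) :
    ∑ z ∈ T.nbr x, chebKernel Q (m + 1) (T.graph.dist z y)
      = √Q * (chebKernel Q (m + 2) (T.graph.dist x y) + chebKernel Q m (T.graph.dist x y)) := by
  have hs : √(Q : ℝ) ≠ 0 := by positivity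
  have hs2 : √(Q : ℝ) * √Q = Q := Real.mul_self_sqrt (by positivity)
  have hpar : ∀ n : ℕ, Even (n + 2) ↔ Even n := fun n => by simp [Nat.even_add]
  rw [T.sum_nbr_dist (chebKernel Q (m + 1))]
  generalize T.graph.dist x y = d
  rw [nsmul_eq_mul, nsmul_eq_mul]
  push_cast
  have e0 : √(Q : ℝ) * (√Q)⁻¹ ^ (m + 2) = (√Q)⁻¹ ^ (m + 1) := by
    rw [pow_succ _ (m + 1)]; field_simp
  have e1 : √(Q : ℝ) * (√Q)⁻¹ ^ m = Q * (√Q)⁻¹ ^ (m + 1) := by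
    have : (√(Q : ℝ))⁻¹ * Q = √Q := by rw [inv_mul_eq_iff_eq_mul₀ hs, hs2]
    rw [pow_succ, mul_comm (Q : ℝ), mul_assoc, this, mul_comm]
  rw [mul_add]
  rcases d with _ | d
  · simp only [chebKernel, ↓reduceIte, Nat.le_add_left, true_and, zero_le, add_zero, hpar,
      add_assoc, Nat.reduceAdd]
    by_cases h : Even m
    · simp only [h, ↓reduceIte, e0, e1]; ring
    · simp [h]
  · have h1 : Even (m + 1 + (d + 1 - 1)) ↔ Even (m + d + 1) := by
      rw [show m + 1 + (d + 1 - 1) = m + d + 1 by omega]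
    have h2 : Even (m + 1 + (d + 1 + 1)) ↔ Even (m + d + 1) := by
      rw [show m + 1 + (d + 1 + 1) = m + d + 1 + 2 by omega, hpar]
    have h3 : Even (m + 2 + (d + 1)) ↔ Even (m + d + 1) := by
      rw [show m + 2 + (d + 1) = m + d + 1 + 2 by omega, hpar]
    have h4 : Even (m + (d + 1)) ↔ Even (m + d + 1) := by rw [show m + (d + 1) = m + d + 1 by omega]
    simp only [chebKernel, h1, h2, h3, h4, Nat.add_eq_zero_iff, one_ne_zero, and_false, ↓reduceIte,
      mul_ite, e0, e1, mul_zero]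
    by_cases he : Even (m + d + 1)
    · have e3 : d + 1 + 1 ≤ m + 1 ↔ d + 1 ≤ m := by omega
      have e4 : d + 1 - 1 ≤ m + 1 ↔ d + 1 ≤ m + 2 := by omega
      simp only [he, and_true, e3, e4]
    · simp [he]

lemma hasSum_chebKernel_zero (g : T.V → ℂ) (x : T.V) :
    HasSum (fun y => (chebKernel Q 0 (T.graph.dist x y) : ℂ) * g y) (g x) := by
  classical
  convert hasSum_ite_eq x (g x) using 2 with y
  rw [chebKernel_zero]
  rcases eq_or_ne y x with rfl | h
  · simp
  · have : T.graph.dist x y ≠ 0 := by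
      rw [Ne, T.isTree.connected.dist_eq_zero_iff]; exact h.symm
    simp [this, h]

/-- Functions satisfying the Chebyshev recursion for the adjacency operator are given by the
radial kernels `chebKernel`. -/
lemma hasSum_chebKernel (hQ : 2 ≤ Q) (g : T.V → ℂ) (w : ℕ → T.V → ℂ) (h0 : w 0 = g)
    (h1 : ∀ x, ∑ z ∈ T.nbr x, w 0 z = √Q * w 1 x)
    (h2 : ∀ m x, ∑ z ∈ T.nbr x, w (m + 1) z = √Q * (w (m + 2) x + w m x)) (m : ℕ) (x : T.V) :
    HasSum (fun y => (chebKernel Q m (T.graph.dist x y) : ℂ) * g y) (w m x) := by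
  have hs : ((√Q : ℝ) : ℂ) ≠ 0 := by
    rw [Complex.ofReal_ne_zero]; positivity
  induction m using Nat.twoStepInduction generalizing x with
  | zero => rw [h0]; exact T.hasSum_chebKernel_zero g x
  | one =>
    rw [h0] at h1
    have key := hasSum_sum fun z (_ : z ∈ T.nbr x) => T.hasSum_chebKernel_zero g z
    simp only [← Finset.sum_mul, ← Complex.ofReal_sum, T.sum_nbr_chebKernel_zero hQ, h1,
      Complex.ofReal_mul, mul_assoc] at key
    exact (hasSum_mul_left_iff hs).1 key
  | more m ih ih' =>
    have key := hasSum_sum fun z (_ : z ∈ T.nbr x) => ih' z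
    simp only [← Finset.sum_mul, ← Complex.ofReal_sum, T.sum_nbr_chebKernel_succ hQ, h2,
      Complex.ofReal_mul, mul_assoc] at key
    have h3 := ((hasSum_mul_left_iff hs).1 key).sub (ih x)
    simpa [add_mul] using h3

/-- The spherical function at the bottom of the `ℓ²` spectrum, centred at `o`. -/
def spherical (o x : T.V) : ℝ :=
  (√Q)⁻¹ ^ T.graph.dist x o * (1 + ((Q : ℝ) - 1) / (Q + 1) * T.graph.dist x o)

lemma spherical_pos (hQ : 2 ≤ Q) (o x : T.V) : 0 < T.spherical o x := by
  have : (2 : ℝ) ≤ Q := by exact_mod_cast hQ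
  have h1 : 0 ≤ ((Q : ℝ) - 1) / (Q + 1) := div_nonneg (by linarith) (by linarith)
  unfold spherical; positivity

lemma sum_nbr_spherical (hQ : 2 ≤ Q) (o x : T.V) :
    ∑ z ∈ T.nbr x, T.spherical o z = 2 * √Q * T.spherical o x := by
  have hs : √(Q : ℝ) ≠ 0 := by positivity
  have hs2 : √(Q : ℝ) * √Q = Q := Real.mul_self_sqrt (by positivity)
  unfold spherical
  rw [T.sum_nbr_dist (fun d => (√Q)⁻¹ ^ d * (1 + ((Q : ℝ) - 1) / (Q + 1) * d))]
  generalize T.graph.dist x o = d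
  rw [nsmul_eq_mul, nsmul_eq_mul]
  set c := ((Q : ℝ) - 1) / (Q + 1)
  rcases d with _ | d
  · have hc : (Q + 1) * (1 + c) = 2 * (Q : ℝ) := by
      simp only [c]; field_simp; ring
    simp only [↓reduceIte, Nat.cast_add, Nat.cast_one, pow_one, mul_one, pow_zero, CharP.cast_eq_zero,
      mul_zero, add_zero]
    have : (√(Q : ℝ))⁻¹ * Q = √Q := by rw [inv_mul_eq_iff_eq_mul₀ hs, hs2]
    rw [mul_left_comm, hc, mul_left_comm, this]
  · simp only [Nat.add_eq_zero_iff, one_ne_zero, and_false, ↓reduceIte, add_tsub_cancel_right]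
    push_cast
    have e1 : 2 * √(Q : ℝ) * (√Q)⁻¹ ^ (d + 1) = 2 * (√Q)⁻¹ ^ d := by
      rw [pow_succ]; field_simp
    have e2 : (Q : ℝ) * (√Q)⁻¹ ^ (d + 1 + 1) = (√Q)⁻¹ ^ d := by
      rw [pow_succ, pow_succ]; nth_rewrite 1 [← hs2]; field_simp
    rw [← mul_assoc, ← mul_assoc, e1, e2]
    ring

lemma hasSum_chebKernel_spherical (hQ : 2 ≤ Q) (o : T.V) (m : ℕ) (x : T.V) :
    HasSum (fun y => chebKernel Q m (T.graph.dist x y) * T.spherical o y)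
      ((m + 1) * T.spherical o x) := by
  have h := T.hasSum_chebKernel hQ (fun y => (T.spherical o y : ℂ))
    (fun m y => (((m + 1) * T.spherical o y : ℝ) : ℂ)) (by simp)
    (fun x => by
      rw [← Complex.ofReal_sum, ← Finset.mul_sum, T.sum_nbr_spherical hQ]; push_cast; ring)
    (fun m x => by
      rw [← Complex.ofReal_sum, ← Finset.mul_sum, T.sum_nbr_spherical hQ]; push_cast; ring) m x
  simp only [← Complex.ofReal_mul] at h
  exact Complex.hasSum_ofReal.1 h

end HomTree

namespace HomTree

variable {Q : ℕ} (T : HomTree Q)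

/-- The Hilbert space of square summable functions on the vertices. -/
abbrev L2 : Type := lp (fun _ : T.V => ℂ) 2

lemma sum_sq_le_norm_sq (g : T.L2) (s : Finset T.V) : ∑ x ∈ s, ‖g x‖ ^ 2 ≤ ‖g‖ ^ 2 := by
  simpa using lp.sum_rpow_le_norm_rpow (p := 2) (by simp) g s

lemma norm_apply_le (g : T.L2) (x : T.V) : ‖g x‖ ≤ ‖g‖ :=
  lp.norm_apply_le_norm (by simp) g x

lemma sum_norm_sum_nbr_sq_le (g : T.L2) (s : Finset T.V) :
    ∑ x ∈ s, ‖∑ z ∈ T.nbr x, g z‖ ^ 2 ≤ (((Q : ℝ) + 1) * ‖g‖) ^ 2 := by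
  classical
  have h1 (x : T.V) : ‖∑ z ∈ T.nbr x, g z‖ ^ 2 ≤ ((Q : ℝ) + 1) * ∑ z ∈ T.nbr x, ‖g z‖ ^ 2 := by
    have := sq_sum_le_card_mul_sum_sq (s := T.nbr x) (f := fun z => ‖g z‖)
    rw [card_nbr] at this
    push_cast at this
    exact (pow_le_pow_left₀ (norm_nonneg _) (norm_sum_le _ _) 2).trans this
  have h2 : ∑ x ∈ s, ∑ z ∈ T.nbr x, ‖g z‖ ^ 2 =
      ∑ z ∈ s.biUnion T.nbr, ∑ x ∈ s.filter (· ∈ T.nbr z), ‖g z‖ ^ 2 := by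
    refine Finset.sum_comm' fun x z => ?_
    simp only [Finset.mem_biUnion, Finset.mem_filter]
    rw [T.mem_nbr_comm (x := x)]
    exact ⟨fun h => ⟨h, x, h.1, T.mem_nbr_comm.1 h.2⟩, fun h => h.1⟩
  calc ∑ x ∈ s, ‖∑ z ∈ T.nbr x, g z‖ ^ 2
      ≤ ∑ x ∈ s, ((Q : ℝ) + 1) * ∑ z ∈ T.nbr x, ‖g z‖ ^ 2 := Finset.sum_le_sum fun x _ => h1 x
    _ = ((Q : ℝ) + 1) * ∑ z ∈ s.biUnion T.nbr, ∑ x ∈ s.filter (· ∈ T.nbr z), ‖g z‖ ^ 2 := by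
      rw [← Finset.mul_sum, h2]
    _ ≤ ((Q : ℝ) + 1) * ∑ z ∈ s.biUnion T.nbr, ((Q : ℝ) + 1) * ‖g z‖ ^ 2 := by
      gcongr with z
      rw [Finset.sum_const, nsmul_eq_mul]
      gcongr
      have : (s.filter (· ∈ T.nbr z)).card ≤ (T.nbr z).card :=
        Finset.card_le_card fun y hy => (Finset.mem_filter.1 hy).2
      rw [card_nbr] at this
      exact_mod_cast this
    _ ≤ ((Q : ℝ) + 1) * (((Q : ℝ) + 1) * ‖g‖ ^ 2) := by
      rw [← Finset.mul_sum]
      gcongr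
      exact T.sum_sq_le_norm_sq g _
    _ = _ := by ring

/-- The adjacency operator on `ℓ²`. -/
def adj : T.L2 →L[ℂ] T.L2 :=
  LinearMap.mkContinuous
    { toFun := fun g => ⟨fun x => ∑ z ∈ T.nbr x, g z, memℓp_gen'
        (C := (((Q : ℝ) + 1) * ‖g‖) ^ 2) (by simpa using T.sum_norm_sum_nbr_sq_le g)⟩
      map_add' := fun g h => by
        ext x
        exact Finset.sum_add_distrib
      map_smul' := fun c g => by
        ext x
        exact (Finset.mul_sum _ _ _).symm }
    (Q + 1) (fun g => lp.norm_le_of_forall_sum_le (by simp) (by positivity) (by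
      simpa using T.sum_norm_sum_nbr_sq_le g))

lemma adj_apply (g : T.L2) (x : T.V) : T.adj g x = ∑ z ∈ T.nbr x, g z := rfl

lemma inner_adj (g h : T.L2) : inner ℂ (T.adj g) h = inner ℂ g (T.adj h) := by
  classical
  have hs := lp.hasSum_single (p := 2) (by simp) h
  have h1 := hs.mapL (innerSL ℂ (T.adj g))
  have h2 := hs.mapL ((innerSL ℂ g).comp T.adj)
  suffices hsx : ∀ x, innerSL ℂ (T.adj g) (lp.single 2 x (h x)) =
      (innerSL ℂ g).comp T.adj (lp.single 2 x (h x)) from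
    h1.unique (by simp only [hsx]; exact h2)
  intro x
  have hA : T.adj (lp.single 2 x (h x)) = ∑ z ∈ T.nbr x, lp.single 2 z (h x) := by
    ext y
    rw [adj_apply, lp.coeFn_sum, Finset.sum_apply]
    simp only [lp.single_apply, Pi.single_apply, Finset.sum_ite_eq, Finset.sum_ite_eq']
    simp only [T.mem_nbr_comm (x := x)]
  simp only [innerSL_apply_apply, ContinuousLinearMap.comp_apply, hA, inner_sum,
    lp.inner_single_right, adj_apply, sum_inner]

/-- The adjacency operator normalised to have spectrum in `[-1, 1]`. -/
def nadj : T.L2 →L[ℂ] T.L2 := ((2 * √Q : ℝ)⁻¹ : ℂ) • T.adj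

/-- Chebyshev polynomials of the second kind of the normalised adjacency operator. -/
def chebOp : ℕ → T.L2 →L[ℂ] T.L2
  | 0 => 1
  | 1 => (2 : ℂ) • T.nadj
  | m + 2 => (2 : ℂ) • (T.nadj * chebOp (m + 1)) - chebOp m

lemma two_nadj_apply (g : T.L2) (x : T.V) (hQ : 2 ≤ Q) :
    (√Q : ℂ) * ((2 : ℂ) • T.nadj g) x = ∑ z ∈ T.nbr x, g z := by
  have hs : ((√Q : ℝ) : ℂ) ≠ 0 := by
    rw [Complex.ofReal_ne_zero]; positivity
  rw [← adj_apply, nadj]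
  simp only [smul_apply, lp.coeFn_smul, Pi.smul_apply, smul_eq_mul]
  push_cast
  field_simp

lemma hasSum_chebOp (hQ : 2 ≤ Q) (m : ℕ) (g : T.L2) (x : T.V) :
    HasSum (fun y => (chebKernel Q m (T.graph.dist x y) : ℂ) * g y) (T.chebOp m g x) := by
  refine T.hasSum_chebKernel hQ g (fun m => T.chebOp m g) rfl (fun x => ?_) (fun m x => ?_) m x
  · exact (T.two_nadj_apply g x hQ).symm
  · rw [← T.two_nadj_apply _ x hQ]
    have h : T.chebOp (m + 2) g =
        ((2 : ℂ) • T.nadj) (T.chebOp (m + 1) g) - T.chebOp m g := rfl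
    rw [h, lp.coeFn_sub, Pi.sub_apply, sub_add_cancel]
    rfl

/-- A crude exponential bound for the norms of the operators `chebOp`. -/
def chebRate : ℝ := ‖(2 : ℂ) • T.nadj‖ + 1

lemma one_le_chebRate : 1 ≤ T.chebRate := by
  unfold chebRate; linarith [norm_nonneg ((2 : ℂ) • T.nadj)]

lemma norm_chebOp_le (m : ℕ) : ‖T.chebOp m‖ ≤ T.chebRate ^ m := by
  have hR := T.one_le_chebRate
  induction m using Nat.twoStepInduction with
  | zero => rw [pow_zero]; exact ContinuousLinearMap.norm_id_le
  | one => simp [chebOp, chebRate]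
  | more m ih ih' =>
    have h1 : ‖(2 : ℂ) • (T.nadj * T.chebOp (m + 1))‖ ≤
        (T.chebRate - 1) * T.chebRate ^ (m + 1) := by
      rw [← smul_mul_assoc]
      refine (norm_mul_le _ _).trans ?_
      gcongr
      · unfold chebRate; linarith
    refine (norm_sub_le _ _).trans ((add_le_add h1 ih).trans ?_)
    have : T.chebRate ^ m ≤ T.chebRate ^ (m + 1) := pow_le_pow_right₀ hR (by omega)
    rw [pow_succ T.chebRate (m + 1)]
    linarith

end HomTree

/-- Hölder's inequality for sums of weighted geometric means. -/
lemma ENNReal.tsum_rpow_mul_rpow_le {α : Type*} (f g : α → ℝ≥0∞) {p q : ℝ} (hp : 0 ≤ p)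
    (hq : 0 ≤ q) (hpq : p + q = 1) :
    ∑' a, f a ^ p * g a ^ q ≤ (∑' a, f a) ^ p * (∑' a, g a) ^ q := by
  let : MeasurableSpace α := ⊤
  simpa only [lintegral_count] using
    ENNReal.lintegral_mul_norm_pow_le (μ := Measure.count) (f := f) (g := g)
      (measurable_from_top.aemeasurable) (measurable_from_top.aemeasurable) hp hq hpq

/-- Interpolation between the trivial bound and Schur's test for a symmetric kernel. -/
lemma ENNReal.tsum_kernel_le {V : Type*} {K : V → V → ℝ≥0∞} {h : V → ℝ≥0∞} {κ Λ : ℝ≥0∞}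
    (hK : ∀ x y, K x y = K y x) (hκ : ∀ x y, K x y ≤ κ) (h0 : ∀ x, h x ≠ 0) (htop : ∀ x, h x ≠ ∞)
    (hΛ : ∀ x, ∑' y, K x y * h y ≤ Λ * h x) (P R : V → ℝ≥0∞) {a : ℝ} (ha : 1 / 2 ≤ a)
    (ha1 : a ≤ 1) :
    ∑' x, ∑' y, K x y * P y ^ a * R x ^ a ≤
      κ ^ (2 * a - 1) * Λ ^ (2 - 2 * a) * ((∑' y, P y) ^ a * (∑' x, R x) ^ a) := by
  have hθ : 0 ≤ 2 * a - 1 := by linarith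
  have hθ' : 0 ≤ 2 - 2 * a := by linarith
  have ha0 : 0 ≤ a := by linarith
  have schur (S : V → ℝ≥0∞) : ∑' y, ∑' x, K x y * (S y * (h x / h y)) ≤ Λ * ∑' y, S y := by
    rw [← ENNReal.tsum_mul_left]
    refine ENNReal.tsum_le_tsum fun y => ?_
    calc ∑' x, K x y * (S y * (h x / h y)) = (S y / h y) * ∑' x, K y x * h x := by
          rw [← ENNReal.tsum_mul_left]
          refine tsum_congr fun x => ?_
          rw [hK x y, div_eq_mul_inv, div_eq_mul_inv]; ring
      _ ≤ (S y / h y) * (Λ * h y) := by gcongr; exact hΛ y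
      _ = Λ * (S y * ((h y)⁻¹ * h y)) := by rw [div_eq_mul_inv]; ring
      _ = Λ * S y := by rw [ENNReal.inv_mul_cancel (h0 y) (htop y), mul_one]
  have h1 : ∑' z : V × V, K z.1 z.2 * P z.2 * R z.1 ≤ κ * ((∑' y, P y) * ∑' x, R x) := by
    rw [ENNReal.tsum_prod (f := fun x y => K x y * P y * R x)]
    calc ∑' x, ∑' y, K x y * P y * R x ≤ ∑' x, ∑' y, κ * P y * R x := by
          gcongr with x y; exact hκ x y
      _ = κ * ((∑' y, P y) * ∑' x, R x) := by
          simp only [ENNReal.tsum_mul_right, ENNReal.tsum_mul_left, mul_assoc]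
  have h2 : ∑' z : V × V, K z.1 z.2 * P z.2 ^ (1 / 2 : ℝ) * R z.1 ^ (1 / 2 : ℝ) ≤
      Λ * ((∑' y, P y) ^ (1 / 2 : ℝ) * (∑' x, R x) ^ (1 / 2 : ℝ)) := by
    have e (z : V × V) : K z.1 z.2 * P z.2 ^ (1 / 2 : ℝ) * R z.1 ^ (1 / 2 : ℝ) =
        (K z.1 z.2 * (P z.2 * (h z.1 / h z.2))) ^ (1 / 2 : ℝ) *
          (K z.2 z.1 * (R z.1 * (h z.2 / h z.1))) ^ (1 / 2 : ℝ) := by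
      have hh : h z.1 / h z.2 * (h z.2 / h z.1) = 1 := by
        rw [div_eq_mul_inv, div_eq_mul_inv]
        calc h z.1 * (h z.2)⁻¹ * (h z.2 * (h z.1)⁻¹) =
              (h z.1)⁻¹ * h z.1 * ((h z.2)⁻¹ * h z.2) := by ring
          _ = 1 := by
            rw [ENNReal.inv_mul_cancel (h0 _) (htop _), ENNReal.inv_mul_cancel (h0 _) (htop _),
              mul_one]
      have hk2 : K z.1 z.2 = (K z.1 z.2 * K z.1 z.2) ^ (1 / 2 : ℝ) := by
        rw [← sq, ← ENNReal.rpow_natCast, ← ENNReal.rpow_mul]; norm_num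
      nth_rewrite 1 [hk2]
      rw [← ENNReal.mul_rpow_of_nonneg _ _ (by norm_num), ← ENNReal.mul_rpow_of_nonneg _ _ (by norm_num),
        ← ENNReal.mul_rpow_of_nonneg _ _ (by norm_num), hK z.2 z.1]
      congr 1
      calc K z.1 z.2 * K z.1 z.2 * P z.2 * R z.1 = K z.1 z.2 * K z.1 z.2 * P z.2 * R z.1 *
            (h z.1 / h z.2 * (h z.2 / h z.1)) := by rw [hh, mul_one]
        _ = _ := by ring
    simp only [e]
    refine (ENNReal.tsum_rpow_mul_rpow_le _ _ (by norm_num) (by norm_num) (by norm_num)).trans ?_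
    have l1 : ∑' z : V × V, K z.1 z.2 * (P z.2 * (h z.1 / h z.2)) ≤ Λ * ∑' y, P y := by
      rw [ENNReal.tsum_prod (f := fun x y => K x y * (P y * (h x / h y))), ENNReal.tsum_comm]
      exact schur P
    have l2 : ∑' z : V × V, K z.2 z.1 * (R z.1 * (h z.2 / h z.1)) ≤ Λ * ∑' y, R y := by
      rw [ENNReal.tsum_prod (f := fun x y => K y x * (R x * (h y / h x)))]
      exact schur R
    have l3 : Λ = Λ ^ (1 / 2 : ℝ) * Λ ^ (1 / 2 : ℝ) := by
      rw [← ENNReal.rpow_add_of_nonneg _ _ (by norm_num) (by norm_num)]; norm_num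
    calc _ ≤ (Λ * ∑' y, P y) ^ (1 / 2 : ℝ) * (Λ * ∑' y, R y) ^ (1 / 2 : ℝ) := by
          gcongr
      _ = Λ ^ (1 / 2 : ℝ) * Λ ^ (1 / 2 : ℝ) *
          ((∑' y, P y) ^ (1 / 2 : ℝ) * (∑' x, R x) ^ (1 / 2 : ℝ)) := by
          rw [ENNReal.mul_rpow_of_nonneg _ _ (by norm_num), ENNReal.mul_rpow_of_nonneg _ _ (by norm_num)]
          ring
      _ = _ := by rw [← l3]
  have split (s : ℝ≥0∞) : s ^ a = s ^ (2 * a - 1) * (s ^ (1 / 2 : ℝ)) ^ (2 - 2 * a) := by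
    rw [← ENNReal.rpow_mul, ← ENNReal.rpow_add_of_nonneg _ _ hθ (by linarith)]
    congr 1; ring
  have split1 (s : ℝ≥0∞) : s = s ^ (2 * a - 1) * s ^ (2 - 2 * a) := by
    rw [← ENNReal.rpow_add_of_nonneg _ _ hθ hθ']
    ring_nf; simp
  rw [← ENNReal.tsum_prod (f := fun x y => K x y * P y ^ a * R x ^ a)]
  calc ∑' z : V × V, K z.1 z.2 * P z.2 ^ a * R z.1 ^ a
      = ∑' z : V × V, (K z.1 z.2 * P z.2 * R z.1) ^ (2 * a - 1) *
          (K z.1 z.2 * P z.2 ^ (1 / 2 : ℝ) * R z.1 ^ (1 / 2 : ℝ)) ^ (2 - 2 * a) := by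
        refine tsum_congr fun z => ?_
        simp only [ENNReal.mul_rpow_of_nonneg _ _ hθ, ENNReal.mul_rpow_of_nonneg _ _ hθ']
        rw [split (P z.2), split (R z.1)]
        nth_rewrite 1 [split1 (K z.1 z.2)]
        ring
    _ ≤ (κ * ((∑' y, P y) * ∑' x, R x)) ^ (2 * a - 1) *
          (Λ * ((∑' y, P y) ^ (1 / 2 : ℝ) * (∑' x, R x) ^ (1 / 2 : ℝ))) ^ (2 - 2 * a) := by
        refine (ENNReal.tsum_rpow_mul_rpow_le _ _ hθ hθ' (by ring)).trans ?_
        gcongr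
    _ = _ := by
        simp only [ENNReal.mul_rpow_of_nonneg _ _ hθ, ENNReal.mul_rpow_of_nonneg _ _ hθ']
        rw [split (∑' y, P y), split (∑' x, R x)]
        ring

namespace HomTree

variable {Q : ℕ} (T : HomTree Q)

/-- The `(γ+1)`-th power of the `ℓ^{γ+1}` norm. -/
def potential (γ : ℝ) (φ : T.L2) : ℝ := ∑' x, ‖φ x‖ ^ (γ + 1)

lemma norm_rpow_le {γ : ℝ} (hγ : 1 ≤ γ) (φ : T.L2) {S : ℝ} (hS : ∀ x, ‖φ x‖ ≤ S) (x : T.V) :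
    ‖φ x‖ ^ (γ + 1) ≤ S ^ (γ - 1) * ‖φ x‖ ^ 2 := by
  have e : ‖φ x‖ ^ (γ + 1) = ‖φ x‖ ^ (γ - 1) * ‖φ x‖ ^ 2 := by
    rw [← Real.rpow_natCast, ← Real.rpow_add_of_nonneg (norm_nonneg _) (by linarith) (by simp)]
    congr 1; push_cast; ring
  rw [e]
  exact mul_le_mul_of_nonneg_right
    (Real.rpow_le_rpow (norm_nonneg _) (hS x) (by linarith)) (by positivity)

lemma hasSum_norm_sq (φ : T.L2) : HasSum (fun x => ‖φ x‖ ^ 2) (‖φ‖ ^ 2) := by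
  simpa using lp.hasSum_norm (p := 2) (by simp) φ

lemma summable_potential {γ : ℝ} (hγ : 1 ≤ γ) (φ : T.L2) :
    Summable fun x => ‖φ x‖ ^ (γ + 1) :=
  Summable.of_nonneg_of_le (fun x => by positivity) (T.norm_rpow_le hγ φ (T.norm_apply_le φ))
    ((T.hasSum_norm_sq φ).summable.mul_left _)

lemma potential_le {γ : ℝ} (hγ : 1 ≤ γ) (φ : T.L2) {S : ℝ} (hS : ∀ x, ‖φ x‖ ≤ S) :
    T.potential γ φ ≤ S ^ (γ - 1) * ‖φ‖ ^ 2 := by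
  have h := T.hasSum_norm_sq φ
  rw [potential, ← h.tsum_eq, ← tsum_mul_left]
  exact (T.summable_potential hγ φ).tsum_le_tsum (T.norm_rpow_le hγ φ hS) (h.summable.mul_left _)

lemma potential_nonneg (γ : ℝ) (φ : T.L2) : 0 ≤ T.potential γ φ :=
  tsum_nonneg fun x => by positivity

lemma ofReal_potential {γ : ℝ} (hγ : 1 ≤ γ) (φ : T.L2) :
    ENNReal.ofReal (T.potential γ φ) = ∑' x, ‖φ x‖ₑ ^ (γ + 1) := by
  rw [potential, ENNReal.ofReal_tsum_of_nonneg (fun x => by positivity)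
    (T.summable_potential hγ φ)]
  refine tsum_congr fun x => ?_
  rw [← ENNReal.ofReal_rpow_of_nonneg (norm_nonneg _) (by linarith), ofReal_norm]

lemma norm_inner_chebOp_le (hQ : 2 ≤ Q) {γ : ℝ} (hγ : 1 ≤ γ) {g h φ ψ : T.L2}
    (hg : ∀ x, ‖g x‖ ≤ ‖φ x‖ ^ γ) (hh : ∀ x, ‖h x‖ ≤ ‖ψ x‖ ^ γ) (m : ℕ) :
    ‖inner ℂ (T.chebOp m g) h‖ ≤
      ((√Q)⁻¹ ^ m) ^ ((γ - 1) / (γ + 1)) * ((m : ℝ) + 1) ^ (2 / (γ + 1)) *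
        (T.potential γ φ ^ (γ / (γ + 1)) * T.potential γ ψ ^ (γ / (γ + 1))) := by
  have hγ1 : 0 < γ + 1 := by linarith
  obtain ⟨o⟩ := T.isTree.connected.nonempty
  set K : T.V → T.V → ℝ≥0∞ := fun x y => ENNReal.ofReal (chebKernel Q m (T.graph.dist x y))
  have key := ENNReal.tsum_kernel_le (K := K) (h := fun x => ENNReal.ofReal (T.spherical o x))
    (κ := ENNReal.ofReal ((√Q)⁻¹ ^ m)) (Λ := ENNReal.ofReal ((m : ℝ) + 1))
    (fun x y => by simp only [K, T.graph.dist_comm])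
    (fun x y => ENNReal.ofReal_le_ofReal (chebKernel_le _ _ _))
    (fun x => (ENNReal.ofReal_pos.2 (T.spherical_pos hQ o x)).ne') (fun x => ENNReal.ofReal_ne_top)
    (fun x => by
      have := T.hasSum_chebKernel_spherical hQ o m x
      rw [← ENNReal.ofReal_mul (by positivity), ← this.tsum_eq, ENNReal.ofReal_tsum_of_nonneg
        (fun y => mul_nonneg (chebKernel_nonneg _ _ _) (T.spherical_pos hQ o y).le) this.summable]
      exact (tsum_congr fun y => (ENNReal.ofReal_mul (chebKernel_nonneg _ _ _)).symm).le)
    (fun x => ‖φ x‖ₑ ^ (γ + 1)) (fun x => ‖ψ x‖ₑ ^ (γ + 1)) (a := γ / (γ + 1))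
    (by rw [div_le_div_iff₀] <;> linarith) (by rw [div_le_one] <;> linarith)
  have ea : 2 * (γ / (γ + 1)) - 1 = (γ - 1) / (γ + 1) := by field_simp; ring
  have eb : 2 - 2 * (γ / (γ + 1)) = 2 / (γ + 1) := by field_simp; ring
  have en (z : ℂ) : (‖z‖ₑ ^ (γ + 1)) ^ (γ / (γ + 1)) = ‖z‖ₑ ^ γ := by
    rw [← ENNReal.rpow_mul]; congr 1; field_simp
  simp only [ea, eb, en, ← T.ofReal_potential hγ] at key
  have hθ : 0 ≤ (γ - 1) / (γ + 1) := div_nonneg (by linarith) hγ1.le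
  have ha : 0 ≤ γ / (γ + 1) := div_nonneg (by linarith) hγ1.le
  rw [ENNReal.ofReal_rpow_of_nonneg (by positivity) hθ,
    ENNReal.ofReal_rpow_of_nonneg (by positivity) (by positivity),
    ENNReal.ofReal_rpow_of_nonneg (T.potential_nonneg _ _) ha,
    ENNReal.ofReal_rpow_of_nonneg (T.potential_nonneg _ _) ha,
    ← ENNReal.ofReal_mul (by positivity), ← ENNReal.ofReal_mul (Real.rpow_nonneg (T.potential_nonneg _ _) _),
    ← ENNReal.ofReal_mul (by positivity)] at key
  have conv {z : ℂ} {r : ℂ} (hz : ‖z‖ ≤ ‖r‖ ^ γ) : ‖z‖ₑ ≤ ‖r‖ₑ ^ γ := by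
    rw [← ofReal_norm, ← ofReal_norm, ENNReal.ofReal_rpow_of_nonneg (norm_nonneg _) (by linarith)]
    exact ENNReal.ofReal_le_ofReal hz
  have hfin : ‖inner ℂ (T.chebOp m g) h‖ₑ ≤ ∑' x, ∑' y, K x y * ‖φ y‖ₑ ^ γ * ‖ψ x‖ₑ ^ γ := by
    rw [lp.inner_eq_tsum]
    refine (enorm_tsum_le_tsum_enorm).trans
      (ENNReal.tsum_le_tsum fun x => ?_)
    rw [ENNReal.tsum_mul_right]
    have hx := T.hasSum_chebOp hQ m g x
    calc ‖inner ℂ (T.chebOp m g x) (h x)‖ₑ ≤ ‖T.chebOp m g x‖ₑ * ‖h x‖ₑ := by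
          rw [← ofReal_norm, ← ofReal_norm, ← ofReal_norm, ← ENNReal.ofReal_mul (norm_nonneg _)]
          exact ENNReal.ofReal_le_ofReal (norm_inner_le_norm _ _)
      _ ≤ _ := by
          gcongr
          · rw [← hx.tsum_eq]
            refine (enorm_tsum_le_tsum_enorm).trans (ENNReal.tsum_le_tsum fun y => ?_)
            rw [enorm_mul]
            gcongr
            · rw [← ofReal_norm, Complex.norm_real, Real.norm_of_nonneg (chebKernel_nonneg _ _ _)]
            · exact conv (hg y)
          · exact conv (hh x)
  have hp : 0 ≤ ((√Q)⁻¹ ^ m) ^ ((γ - 1) / (γ + 1)) * ((m : ℝ) + 1) ^ (2 / (γ + 1)) *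
        (T.potential γ φ ^ (γ / (γ + 1)) * T.potential γ ψ ^ (γ / (γ + 1))) := by
    have h1 := Real.rpow_nonneg (T.potential_nonneg γ φ) (γ / (γ + 1))
    have h2 := Real.rpow_nonneg (T.potential_nonneg γ ψ) (γ / (γ + 1))
    positivity
  rw [← ENNReal.ofReal_le_ofReal_iff hp, ofReal_norm]
  exact hfin.trans key

end HomTree

/-- Van der Corput type bound for a quarter-period oscillatory integral. -/
lemma norm_integral_exp_cos_mul_cos_half_le {τ : ℝ} (hτ : 1 ≤ |τ|) {n : ℕ} (hn : 1 ≤ n) :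
    ‖∫ l in (0 : ℝ)..Real.pi / 2, Complex.exp (-I * τ * Real.cos l) * (Real.cos (n * l) : ℂ)‖ ≤
      9 * n * |τ| ^ (-(1 / 2) : ℝ) := by
  have hn' : (1 : ℝ) ≤ n := by exact_mod_cast hn
  have hτ0 : 0 < |τ| := by linarith
  have hτc : (I * τ : ℂ) ≠ 0 := by
    simp only [ne_eq, mul_eq_zero, I_ne_zero, false_or, ofReal_eq_zero]
    exact abs_pos.1 hτ0
  set δ : ℝ := |τ| ^ (-(1 / 2) : ℝ) with hδ
  have hδ0 : 0 < δ := Real.rpow_pos_of_pos hτ0 _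
  have hδ1 : δ ≤ 1 := Real.rpow_le_one_of_one_le_of_nonpos hτ (by norm_num)
  have hδ2 : δ * δ = |τ|⁻¹ := by
    rw [hδ, ← Real.rpow_add hτ0, ← Real.rpow_neg_one]; norm_num
  have hpi := Real.pi_gt_three
  have hδπ : δ ≤ Real.pi / 2 := by linarith
  set E : ℝ → ℂ := fun l => Complex.exp (-I * τ * Real.cos l) with hE
  have hEn (l : ℝ) : ‖E l‖ = 1 := by
    have : -I * τ * Real.cos l = ((-(τ * Real.cos l) : ℝ) : ℂ) * I := by push_cast; ring
    simp only [hE, this, Complex.norm_exp_ofReal_mul_I]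
  have hEc : Continuous E := by fun_prop
  have hEd (l : ℝ) : HasDerivAt E (I * τ * Real.sin l * E l) l := by
    have h1 : HasDerivAt (fun l : ℝ => (Real.cos l : ℂ)) ((-Real.sin l : ℝ) : ℂ) l :=
      (Real.hasDerivAt_cos l).ofReal_comp
    have h2 := (h1.const_mul (-I * τ)).cexp
    convert h2 using 1
    simp only [hE]; push_cast; ring
  have hsin {l : ℝ} (hl : l ∈ Set.Icc δ (Real.pi / 2)) : 2 / Real.pi * δ ≤ Real.sin l :=
    (mul_le_mul_of_nonneg_left hl.1 (by positivity)).trans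
      (Real.mul_le_sin (hδ0.le.trans hl.1) hl.2)
  have hsin0 {l : ℝ} (hl : l ∈ Set.Icc δ (Real.pi / 2)) : 0 < Real.sin l :=
    lt_of_lt_of_le (by positivity) (hsin hl)
  have hsinv {l : ℝ} (hl : l ∈ Set.Icc δ (Real.pi / 2)) :
      (Real.sin l)⁻¹ ≤ Real.pi / 2 * δ⁻¹ := by
    have := inv_anti₀ (by positivity) (hsin hl)
    rwa [mul_inv, inv_div] at this
  set G : ℝ → ℂ := fun l => ((Real.cos (n * l) / Real.sin l : ℝ) : ℂ)
  set G' : ℝ → ℝ := fun l =>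
    (-Real.sin (n * l) * n * Real.sin l - Real.cos (n * l) * Real.cos l) / Real.sin l ^ 2
  have hGd {l : ℝ} (hl : l ∈ Set.Icc δ (Real.pi / 2)) : HasDerivAt G (G' l) l := by
    have h1 : HasDerivAt (fun l : ℝ => Real.cos (n * l)) (-Real.sin (n * l) * n) l := by
      have := ((hasDerivAt_id l).const_mul (n : ℝ)).cos
      simpa using this
    exact (h1.div (Real.hasDerivAt_sin l) (hsin0 hl).ne').ofReal_comp
  have huIcc : Set.uIcc δ (Real.pi / 2) = Set.Icc δ (Real.pi / 2) := Set.uIcc_of_le hδπ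
  have hG'c : ContinuousOn G' (Set.Icc δ (Real.pi / 2)) := by
    refine ContinuousOn.div (by fun_prop) (by fun_prop) fun l hl => ?_
    exact pow_ne_zero 2 (hsin0 hl).ne'
  have hG'i : IntervalIntegrable (fun l => (G' l : ℂ)) volume δ (Real.pi / 2) := by
    refine ContinuousOn.intervalIntegrable ?_
    rw [huIcc]
    exact Complex.continuous_ofReal.comp_continuousOn hG'c
  have hparts := intervalIntegral.integral_mul_deriv_eq_deriv_mul (a := δ) (b := Real.pi / 2)
    (u := G) (u' := fun l => (G' l : ℂ)) (v := E) (v' := fun l => I * τ * Real.sin l * E l)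
    (fun l hl => hGd (huIcc ▸ hl)) (fun l _ => hEd l) hG'i
    (Continuous.intervalIntegrable (by fun_prop) _ _)
  have hmid : ∫ l in δ..Real.pi / 2, G l * (I * τ * Real.sin l * E l) =
      (I * τ) * ∫ l in δ..Real.pi / 2, E l * (Real.cos (n * l) : ℂ) := by
    rw [← intervalIntegral.integral_const_mul]
    refine intervalIntegral.integral_congr fun l hl => ?_
    rw [huIcc] at hl
    have : (Real.sin l : ℂ) ≠ 0 := by exact_mod_cast (hsin0 hl).ne'
    simp only [G]
    push_cast
    push_cast at this
    field_simp
  have h_int : ‖∫ l in δ..Real.pi / 2, (G' l : ℂ) * E l‖ ≤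
      n * (Real.pi / 2 * δ⁻¹) * (Real.pi / 2) + Real.pi / 2 * δ⁻¹ := by
    set H : ℝ → ℝ := fun l => n * (Real.pi / 2 * δ⁻¹) * l - (Real.sin l)⁻¹
    set H' : ℝ → ℝ := fun l => n * (Real.pi / 2 * δ⁻¹) - -Real.cos l / Real.sin l ^ 2
    have hHd {l : ℝ} (hl : l ∈ Set.Icc δ (Real.pi / 2)) : HasDerivAt H (H' l) l := by
      have h1 := ((hasDerivAt_id l).const_mul (n * (Real.pi / 2 * δ⁻¹)))
      rw [mul_one] at h1
      exact h1.sub ((Real.hasDerivAt_sin l).inv (hsin0 hl).ne')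
    have hH'i : IntervalIntegrable H' volume δ (Real.pi / 2) := by
      refine ContinuousOn.intervalIntegrable ?_
      rw [huIcc]
      refine continuousOn_const.sub (ContinuousOn.div (by fun_prop) (by fun_prop) fun l hl => ?_)
      exact pow_ne_zero 2 (hsin0 hl).ne'
    have hle := intervalIntegral.norm_integral_le_of_norm_le (μ := volume) hδπ
      (f := fun l => (G' l : ℂ) * E l) (g := H') (Eventually.of_forall fun l hl => by
        have hl' : l ∈ Set.Icc δ (Real.pi / 2) := ⟨hl.1.le, hl.2⟩
        have hs := hsin0 hl'
        have hc : 0 ≤ Real.cos l := Real.cos_nonneg_of_mem_Icc ⟨by linarith [hl.1], hl.2⟩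
        rw [norm_mul, hEn, mul_one, Complex.norm_real, Real.norm_eq_abs]
        have e : G' l = -(Real.sin (n * l) * n * (Real.sin l)⁻¹) -
            Real.cos (n * l) * (Real.cos l / Real.sin l ^ 2) := by
          simp only [G']; field_simp
        have e2 : H' l = n * (Real.pi / 2 * δ⁻¹) + Real.cos l / Real.sin l ^ 2 := by
          simp only [H']; ring
        rw [e, e2]
        refine (abs_sub _ _).trans ?_
        rw [abs_neg, abs_mul, abs_mul, abs_mul, abs_of_pos (inv_pos.2 hs),
          abs_of_nonneg (a := (n : ℝ)) (by positivity),
          abs_of_nonneg (a := Real.cos l / Real.sin l ^ 2) (by positivity)]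
        have a1 := Real.abs_sin_le_one (n * l)
        have a2 := Real.abs_cos_le_one (n * l)
        have a3 := hsinv hl'
        gcongr
        · calc |Real.sin (n * l)| * n ≤ 1 * n := by gcongr
            _ = n := one_mul _
        · exact mul_le_of_le_one_left (by positivity) a2) hH'i
    refine hle.trans ?_
    rw [intervalIntegral.integral_eq_sub_of_hasDerivAt (fun l hl => hHd (huIcc ▸ hl)) hH'i]
    have h1 := hsinv ⟨le_rfl, hδπ⟩
    have h2 : 0 ≤ n * (Real.pi / 2 * δ⁻¹) * δ := by positivity
    simp only [H, Real.sin_pi_div_two, inv_one]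
    linarith
  have hGb {l : ℝ} (hl : l ∈ Set.Icc δ (Real.pi / 2)) : ‖G l * E l‖ ≤ Real.pi / 2 * δ⁻¹ := by
    rw [norm_mul, hEn, mul_one, Complex.norm_real, Real.norm_eq_abs, div_eq_mul_inv, abs_mul,
      abs_of_pos (inv_pos.2 (hsin0 hl))]
    exact (mul_le_of_le_one_left (inv_pos.2 (hsin0 hl)).le (Real.abs_cos_le_one _)).trans (hsinv hl)
  have hmidb : ‖∫ l in δ..Real.pi / 2, E l * (Real.cos (n * l) : ℂ)‖ ≤
      |τ|⁻¹ * (δ⁻¹ * (n * (Real.pi ^ 2 / 4 + 3 * Real.pi / 2))) := by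
    have e : ∫ l in δ..Real.pi / 2, E l * (Real.cos (n * l) : ℂ) = (I * τ)⁻¹ *
        (G (Real.pi / 2) * E (Real.pi / 2) - G δ * E δ -
          ∫ l in δ..Real.pi / 2, (G' l : ℂ) * E l) := by
      rw [← hparts, hmid, inv_mul_cancel_left₀ hτc]
    rw [e, norm_mul, norm_inv, norm_mul, norm_I, one_mul, Complex.norm_real, Real.norm_eq_abs]
    gcongr
    refine (norm_sub_le _ _).trans ((add_le_add (norm_sub_le _ _) h_int).trans ?_)
    have h1 := hGb ⟨hδπ, le_rfl⟩
    have h2 := hGb ⟨le_rfl, hδπ⟩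
    have h3 : δ⁻¹ * (3 * Real.pi / 2) ≤ δ⁻¹ * (n * (3 * Real.pi / 2)) := by
      gcongr
      exact le_mul_of_one_le_left (by positivity) hn'
    linarith
  have hint0 : IntervalIntegrable (fun l => E l * (Real.cos (n * l) : ℂ)) volume 0 δ :=
    Continuous.intervalIntegrable (by fun_prop) _ _
  have hint1 : IntervalIntegrable (fun l => E l * (Real.cos (n * l) : ℂ)) volume δ
      (Real.pi / 2) := Continuous.intervalIntegrable (by fun_prop) _ _
  have h0 : ‖∫ l in (0 : ℝ)..δ, E l * (Real.cos (n * l) : ℂ)‖ ≤ 1 * |δ - 0| :=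
    intervalIntegral.norm_integral_le_of_norm_le_const fun l _ => by
      rw [norm_mul, hEn, one_mul, Complex.norm_real]
      exact Real.abs_cos_le_one _
  rw [sub_zero, one_mul, abs_of_pos hδ0] at h0
  have e3 : |τ|⁻¹ * (δ⁻¹ * (n * (Real.pi ^ 2 / 4 + 3 * Real.pi / 2))) =
      δ * (n * (Real.pi ^ 2 / 4 + 3 * Real.pi / 2)) := by
    rw [← hδ2]; field_simp
  rw [e3] at hmidb
  rw [← intervalIntegral.integral_add_adjacent_intervals hint0 hint1]
  refine (norm_add_le _ _).trans ((add_le_add h0 hmidb).trans ?_)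
  have hpi2 : Real.pi ≤ 3.15 := Real.pi_lt_d2.le
  have hc : Real.pi ^ 2 / 4 + 3 * Real.pi / 2 ≤ 7.3 := by nlinarith
  have h5 : δ * (n * (Real.pi ^ 2 / 4 + 3 * Real.pi / 2)) ≤ δ * (n * 7.3) := by gcongr
  nlinarith [mul_le_mul_of_nonneg_left hn' hδ0.le]

lemma norm_integral_exp_cos_mul_cos_le {τ : ℝ} (hτ : 1 ≤ |τ|) {n : ℕ} (hn : 1 ≤ n) :
    ‖∫ l in (0 : ℝ)..Real.pi, Complex.exp (-I * τ * Real.cos l) * (Real.cos (n * l) : ℂ)‖ ≤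
      18 * n * |τ| ^ (-(1 / 2) : ℝ) := by
  set f : ℝ → ℂ := fun l => Complex.exp (-I * τ * Real.cos l) * (Real.cos (n * l) : ℂ) with hf
  have hfc : Continuous f := by fun_prop
  have h1 := norm_integral_exp_cos_mul_cos_half_le hτ hn
  have h2 := norm_integral_exp_cos_mul_cos_half_le (τ := -τ) (by rwa [abs_neg]) hn
  rw [abs_neg] at h2
  have e : ∫ l in Real.pi / 2..Real.pi, f l = (-1 : ℂ) ^ n * ∫ l in (0 : ℝ)..Real.pi / 2,
      Complex.exp (-I * (-τ : ℝ) * Real.cos l) * (Real.cos (n * l) : ℂ) := by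
    have := intervalIntegral.integral_comp_sub_left (a := 0) (b := Real.pi / 2) f Real.pi
    rw [sub_zero, sub_half] at this
    rw [← this, ← intervalIntegral.integral_const_mul]
    refine intervalIntegral.integral_congr fun l _ => ?_
    simp only [hf, Real.cos_pi_sub]
    have : Real.cos (n * (Real.pi - l)) = (-1) ^ n * Real.cos (n * l) := by
      rw [mul_sub, Real.cos_nat_mul_pi_sub]
    rw [this]
    push_cast
    ring_nf
  rw [← intervalIntegral.integral_add_adjacent_intervals (b := Real.pi / 2)
    (hfc.intervalIntegrable _ _) (hfc.intervalIntegrable _ _), e]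
  refine (norm_add_le _ _).trans ?_
  rw [norm_mul, norm_pow, norm_neg, norm_one, one_pow, one_mul]
  linarith

/-- Chebyshev coefficients of the second kind of `x ↦ exp (-iτx)`. -/
def expChebCoeff (τ : ℝ) (m : ℕ) : ℂ :=
  2 / Real.pi * ∫ l in (0 : ℝ)..Real.pi,
    Complex.exp (-I * τ * Real.cos l) * (Real.sin l : ℂ) * (Real.sin (((m : ℝ) + 1) * l) : ℂ)

lemma norm_exp_neg_I_mul_cos (τ l : ℝ) : ‖Complex.exp (-I * τ * Real.cos l)‖ = 1 := by
  have : -I * τ * Real.cos l = ((-(τ * Real.cos l) : ℝ) : ℂ) * I := by push_cast; ring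
  rw [this, Complex.norm_exp_ofReal_mul_I]

lemma norm_expChebCoeff_le_two (τ : ℝ) (m : ℕ) : ‖expChebCoeff τ m‖ ≤ 2 := by
  have h := intervalIntegral.norm_integral_le_of_norm_le_const (a := 0) (b := Real.pi) (C := 1)
    (f := fun l : ℝ => Complex.exp (-I * τ * Real.cos l) * (Real.sin l : ℂ) *
      (Real.sin (((m : ℝ) + 1) * l) : ℂ)) fun l _ => by
        rw [norm_mul, norm_mul, norm_exp_neg_I_mul_cos, one_mul, Complex.norm_real,
          Complex.norm_real]
        exact mul_le_one₀ (Real.abs_sin_le_one _) (norm_nonneg _) (Real.abs_sin_le_one _)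
  rw [expChebCoeff, norm_mul, norm_div, Complex.norm_real, Real.norm_of_nonneg Real.pi_pos.le]
  rw [sub_zero, abs_of_pos Real.pi_pos, one_mul] at h
  calc _ ≤ ‖(2 : ℂ)‖ / Real.pi * Real.pi := by gcongr
    _ = 2 := by rw [div_mul_cancel₀ _ Real.pi_ne_zero]; simp

lemma norm_expChebCoeff_le_rpow {τ : ℝ} (hτ : 1 ≤ |τ|) (m : ℕ) :
    ‖expChebCoeff τ m‖ ≤ 12 * ((m : ℝ) + 1) ^ 2 * |τ| ^ (-(3 / 2) : ℝ) := by
  have hτ0 : 0 < |τ| := by linarith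
  have hτc : (I * τ : ℂ) ≠ 0 := by
    simp only [ne_eq, mul_eq_zero, I_ne_zero, false_or, ofReal_eq_zero]
    exact abs_pos.1 hτ0
  have hEd (l : ℝ) : HasDerivAt (fun l : ℝ => Complex.exp (-I * τ * Real.cos l))
      (I * τ * Real.sin l * Complex.exp (-I * τ * Real.cos l)) l := by
    have h1 : HasDerivAt (fun l : ℝ => (Real.cos l : ℂ)) ((-Real.sin l : ℝ) : ℂ) l :=
      (Real.hasDerivAt_cos l).ofReal_comp
    convert (h1.const_mul (-I * τ)).cexp using 1
    push_cast; ring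
  have hSd (l : ℝ) : HasDerivAt (fun l : ℝ => (Real.sin (((m : ℝ) + 1) * l) : ℂ))
      ((Real.cos (((m : ℝ) + 1) * l) * (m + 1) : ℝ) : ℂ) l := by
    have := ((hasDerivAt_id l).const_mul ((m : ℝ) + 1)).sin
    rw [mul_one] at this
    exact this.ofReal_comp
  have hparts := intervalIntegral.integral_mul_deriv_eq_deriv_mul (a := 0) (b := Real.pi)
    (fun l _ => hSd l) (fun l _ => hEd l) (Continuous.intervalIntegrable (by fun_prop) _ _)
    (Continuous.intervalIntegrable (by fun_prop) _ _)
  have hs : Real.sin (((m : ℝ) + 1) * Real.pi) = 0 := by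
    exact_mod_cast Real.sin_nat_mul_pi (m + 1)
  rw [hs, mul_zero, Real.sin_zero, Complex.ofReal_zero, zero_mul, zero_mul, sub_zero,
    zero_sub] at hparts
  have e : (I * τ) * ∫ l in (0 : ℝ)..Real.pi, Complex.exp (-I * τ * Real.cos l) *
      (Real.sin l : ℂ) * (Real.sin (((m : ℝ) + 1) * l) : ℂ) =
      -((m + 1 : ℂ) * ∫ l in (0 : ℝ)..Real.pi, Complex.exp (-I * τ * Real.cos l) *
        (Real.cos ((m + 1 : ℕ) * l) : ℂ)) := by
    rw [← intervalIntegral.integral_const_mul, ← intervalIntegral.integral_const_mul]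
    refine Eq.trans ?_ (hparts.trans (congr_arg Neg.neg ?_))
    · refine intervalIntegral.integral_congr fun l _ => ?_
      ring
    · refine intervalIntegral.integral_congr fun l _ => ?_
      push_cast; ring
  have hb := norm_integral_exp_cos_mul_cos_le hτ (n := m + 1) (by omega)
  have hn := congr_arg norm e
  rw [norm_mul, norm_mul, norm_I, one_mul, norm_neg, norm_mul, Complex.norm_real, Real.norm_eq_abs,
    ← eq_inv_mul_iff_mul_eq₀ hτ0.ne'] at hn
  have hm : ‖(m + 1 : ℂ)‖ = m + 1 := by exact_mod_cast Complex.norm_natCast (m + 1)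
  rw [expChebCoeff, norm_mul, hn, norm_div, Complex.norm_real, Real.norm_of_nonneg Real.pi_pos.le,
    hm]
  have e2 : |τ| ^ (-(3 / 2) : ℝ) = |τ|⁻¹ * |τ| ^ (-(1 / 2) : ℝ) := by
    rw [← Real.rpow_neg_one, ← Real.rpow_add hτ0]; norm_num
  have h2 : ‖(2 : ℂ)‖ / Real.pi ≤ 2 / 3 := by
    rw [Complex.norm_ofNat]
    gcongr
    exact Real.pi_gt_three.le
  push_cast at hb
  rw [e2]
  push_cast
  calc _ ≤ 2 / 3 * (|τ|⁻¹ * ((m + 1) * (18 * ((m : ℝ) + 1) * |τ| ^ (-(1 / 2) : ℝ)))) := by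
        gcongr
    _ = _ := by ring

lemma norm_expChebCoeff_le (τ : ℝ) (m : ℕ) :
    ‖expChebCoeff τ m‖ ≤ 36 * ((m : ℝ) + 1) ^ 2 * (1 + |τ|) ^ (-(3 / 2) : ℝ) := by
  have h8 : (1 / 2 : ℝ) ^ (3 / 2 : ℝ) ≥ 1 / 3 := by
    have h : ((1 / 2 : ℝ) ^ (3 / 2 : ℝ)) ^ 2 = 1 / 8 := by
      rw [← Real.rpow_natCast, ← Real.rpow_mul (by norm_num)]; norm_num
    have h0 : (0 : ℝ) ≤ (1 / 2 : ℝ) ^ (3 / 2 : ℝ) := by positivity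
    nlinarith
  have key {a : ℝ} (ha : 0 < a) (h : (1 + |τ|) ≤ 2 * a) :
      a ^ (-(3 / 2) : ℝ) ≤ 3 * (1 + |τ|) ^ (-(3 / 2) : ℝ) := by
    have h1 : (1 / 2 * (1 + |τ|)) ^ (3 / 2 : ℝ) ≤ a ^ (3 / 2 : ℝ) :=
      Real.rpow_le_rpow (by positivity) (by linarith) (by norm_num)
    rw [Real.mul_rpow (by norm_num) (by positivity)] at h1
    rw [Real.rpow_neg ha.le, Real.rpow_neg (by positivity), ← div_eq_mul_inv, inv_eq_one_div,
      div_le_div_iff₀ (by positivity) (by positivity)]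
    have h2 : 0 < (1 + |τ|) ^ (3 / 2 : ℝ) := by positivity
    nlinarith
  rcases le_total 1 |τ| with h | h
  · refine (norm_expChebCoeff_le_rpow h m).trans ?_
    have := key (a := |τ|) (by linarith) (by linarith)
    calc _ ≤ 12 * ((m : ℝ) + 1) ^ 2 * (3 * (1 + |τ|) ^ (-(3 / 2) : ℝ)) := by gcongr
      _ = _ := by ring
  · have := key (a := 1) one_pos (by linarith)
    rw [Real.one_rpow] at this
    have hm : (1 : ℝ) ≤ ((m : ℝ) + 1) ^ 2 := one_le_pow₀ (by linarith [m.cast_nonneg (α := ℝ)])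
    refine (norm_expChebCoeff_le_two τ m).trans ?_
    nlinarith

/-- Chebyshev coefficients of the second kind of the monomials. -/
def powChebCoeff : ℕ → ℕ → ℝ
  | 0, m => if m = 0 then 1 else 0
  | j + 1, 0 => powChebCoeff j 1 / 2
  | j + 1, m + 1 => (powChebCoeff j (m + 2) + powChebCoeff j m) / 2

lemma powChebCoeff_nonneg (j m : ℕ) : 0 ≤ powChebCoeff j m := by
  induction j generalizing m with
  | zero => simp only [powChebCoeff]; split_ifs <;> norm_num
  | succ j ih =>
    rcases m with _ | m
    · exact div_nonneg (ih _) (by norm_num)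
    · exact div_nonneg (add_nonneg (ih _) (ih _)) (by norm_num)

lemma powChebCoeff_le_one (j m : ℕ) : powChebCoeff j m ≤ 1 := by
  induction j generalizing m with
  | zero => simp only [powChebCoeff]; split_ifs <;> norm_num
  | succ j ih =>
    rcases m with _ | m
    · simp only [powChebCoeff]; linarith [ih 1, powChebCoeff_nonneg j 1]
    · simp only [powChebCoeff]; linarith [ih (m + 2), ih m]

lemma powChebCoeff_eq_zero {j m : ℕ} (h : j < m) : powChebCoeff j m = 0 := by
  induction j generalizing m with
  | zero => simp only [powChebCoeff]; rw [if_neg (by omega)]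
  | succ j ih =>
    rcases m with _ | m
    · omega
    · simp only [powChebCoeff]; rw [ih (by omega), ih (by omega)]; norm_num

lemma integral_cos_nat_mul {k : ℕ} (hk : k ≠ 0) :
    ∫ l in (0 : ℝ)..Real.pi, Real.cos (k * l) = 0 := by
  have hk' : (k : ℝ) ≠ 0 := by exact_mod_cast hk
  rw [intervalIntegral.integral_comp_mul_left _ hk', integral_cos, Real.sin_nat_mul_pi]
  simp

lemma integral_cos_pow_mul_sin_mul_sin (j m : ℕ) :
    ∫ l in (0 : ℝ)..Real.pi, Real.cos l ^ j * (Real.sin l * Real.sin (((m : ℝ) + 1) * l)) =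
      Real.pi / 2 * powChebCoeff j m := by
  induction j generalizing m with
  | zero =>
    have e (l : ℝ) : Real.cos l ^ 0 * (Real.sin l * Real.sin (((m : ℝ) + 1) * l)) =
        1 / 2 * (Real.cos ((m : ℕ) * l) - Real.cos ((m + 2 : ℕ) * l)) := by
      have h1 : (m : ℝ) * l = ((m : ℝ) + 1) * l - l := by ring
      have h2 : ((m + 2 : ℕ) : ℝ) * l = ((m : ℝ) + 1) * l + l := by push_cast; ring
      rw [h1, h2, Real.cos_sub, Real.cos_add]; ring
    simp only [e]
    rw [intervalIntegral.integral_const_mul, intervalIntegral.integral_sub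
      (Continuous.intervalIntegrable (by fun_prop) _ _)
      (Continuous.intervalIntegrable (by fun_prop) _ _),
      integral_cos_nat_mul (k := m + 2) (by omega)]
    rcases m with _ | m
    · simp [powChebCoeff]; ring
    · rw [integral_cos_nat_mul (by omega)]; simp [powChebCoeff]
  | succ j ih =>
    rcases m with _ | m
    · have e (l : ℝ) : Real.cos l ^ (j + 1) * (Real.sin l * Real.sin (((0 : ℕ) + 1 : ℝ) * l)) =
          1 / 2 * (Real.cos l ^ j * (Real.sin l * Real.sin (((1 : ℕ) + 1 : ℝ) * l))) := by
        have h : ((1 : ℕ) + 1 : ℝ) * l = 2 * l := by norm_num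
        rw [h, Real.sin_two_mul]
        simp only [Nat.cast_zero, zero_add, one_mul]; ring
      simp only [e]
      rw [intervalIntegral.integral_const_mul, ih]
      simp only [powChebCoeff]; ring
    · have e (l : ℝ) : Real.cos l ^ (j + 1) * (Real.sin l * Real.sin (((m + 1 : ℕ) + 1 : ℝ) * l)) =
          1 / 2 * (Real.cos l ^ j * (Real.sin l * Real.sin (((m + 2 : ℕ) + 1 : ℝ) * l)) +
            Real.cos l ^ j * (Real.sin l * Real.sin (((m : ℕ) + 1 : ℝ) * l))) := by
        have h1 : ((m + 2 : ℕ) + 1 : ℝ) * l = ((m + 1 : ℕ) + 1 : ℝ) * l + l := by push_cast; ring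
        have h2 : ((m : ℕ) + 1 : ℝ) * l = ((m + 1 : ℕ) + 1 : ℝ) * l - l := by push_cast; ring
        rw [h1, h2, Real.sin_add, Real.sin_sub]; ring
      simp only [e]
      rw [intervalIntegral.integral_const_mul, intervalIntegral.integral_add
        (Continuous.intervalIntegrable (by fun_prop) _ _)
        (Continuous.intervalIntegrable (by fun_prop) _ _), ih, ih]
      simp only [powChebCoeff]; ring

lemma hasSum_expChebCoeff (τ : ℝ) (m : ℕ) :
    HasSum (fun j : ℕ => (j.factorial : ℂ)⁻¹ * (-I * τ) ^ j * powChebCoeff j m)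
      (expChebCoeff τ m) := by
  have key := intervalIntegral.hasSum_integral_of_dominated_convergence (μ := volume) (a := 0)
    (b := Real.pi) (ι := ℕ)
    (F := fun j l => (j.factorial : ℂ)⁻¹ * (-I * τ * Real.cos l) ^ j *
      (Real.sin l : ℂ) * (Real.sin (((m : ℝ) + 1) * l) : ℂ))
    (f := fun l => Complex.exp (-I * τ * Real.cos l) * (Real.sin l : ℂ) *
      (Real.sin (((m : ℝ) + 1) * l) : ℂ))
    (fun j _ => |τ| ^ j / j.factorial)
    (fun j => Continuous.aestronglyMeasurable (by fun_prop))
    (fun j => Eventually.of_forall fun l _ => by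
      simp only [norm_mul, norm_inv, norm_pow, norm_neg, norm_I, one_mul, Complex.norm_real,
        Complex.norm_natCast, Real.norm_eq_abs]
      have h1 : |τ| * |Real.cos l| ≤ |τ| :=
        mul_le_of_le_one_right (abs_nonneg _) (Real.abs_cos_le_one _)
      calc (j.factorial : ℝ)⁻¹ * (|τ| * |Real.cos l|) ^ j * |Real.sin l| *
            |Real.sin (((m : ℝ) + 1) * l)| ≤ (j.factorial : ℝ)⁻¹ * |τ| ^ j * 1 * 1 := by
            gcongr
            · exact Real.abs_sin_le_one _
            · exact Real.abs_sin_le_one _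
        _ = _ := by rw [div_eq_mul_inv]; ring)
    (Eventually.of_forall fun l _ => Real.summable_pow_div_factorial _)
    intervalIntegrable_const
    (Eventually.of_forall fun l _ => by
      refine HasSum.mul_right _ (HasSum.mul_right _ ?_)
      rw [Complex.exp_eq_exp_ℂ]
      exact NormedSpace.exp_series_hasSum_exp' (𝕂 := ℂ) (-I * τ * Real.cos l))
  have h2 := key.mul_left (2 / Real.pi : ℂ)
  rw [expChebCoeff]
  suffices h : ∀ j : ℕ, (j.factorial : ℂ)⁻¹ * (-I * τ) ^ j * powChebCoeff j m =
      2 / Real.pi * ∫ l in (0 : ℝ)..Real.pi, (j.factorial : ℂ)⁻¹ * (-I * τ * Real.cos l) ^ j *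
        (Real.sin l : ℂ) * (Real.sin (((m : ℝ) + 1) * l) : ℂ) by
    simp only [h]; exact h2
  intro j
  have e (l : ℝ) : (j.factorial : ℂ)⁻¹ * (-I * τ * Real.cos l) ^ j *
      (Real.sin l : ℂ) * (Real.sin (((m : ℝ) + 1) * l) : ℂ) =
      (j.factorial : ℂ)⁻¹ * (-I * τ) ^ j *
        ((Real.cos l ^ j * (Real.sin l * Real.sin (((m : ℝ) + 1) * l)) : ℝ) : ℂ) := by
    push_cast; ring
  simp only [e]
  rw [intervalIntegral.integral_const_mul, intervalIntegral.integral_ofReal,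
    integral_cos_pow_mul_sin_mul_sin]
  have : (Real.pi : ℂ) ≠ 0 := by exact_mod_cast Real.pi_ne_zero
  push_cast
  field_simp

lemma summable_powChebCoeff_mul (τ : ℝ) {R : ℝ} (hR : 1 ≤ R) :
    Summable fun z : ℕ × ℕ => |τ| ^ z.1 / z.1.factorial * powChebCoeff z.1 z.2 * R ^ z.2 := by
  have hR0 : 0 ≤ R := by linarith
  have hsupp (j : ℕ) : ∀ m ∉ Finset.range (j + 1),
      |τ| ^ j / j.factorial * powChebCoeff j m * R ^ m = 0 := fun m hm => by
    rw [Finset.mem_range] at hm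
    rw [powChebCoeff_eq_zero (by omega)]; simp
  refine (summable_prod_of_nonneg fun z => ?_).2 ⟨fun j => summable_of_ne_finset_zero (hsupp j), ?_⟩
  · exact mul_nonneg (mul_nonneg (by positivity) (powChebCoeff_nonneg _ _)) (by positivity)
  · refine Summable.of_nonneg_of_le (fun j => tsum_nonneg fun m => ?_) (fun j => ?_)
      (Real.summable_pow_div_factorial (|τ| * (2 * R)))
    · exact mul_nonneg (mul_nonneg (by positivity) (powChebCoeff_nonneg _ _)) (by positivity)
    · rw [tsum_eq_sum (hsupp j)]
      calc ∑ m ∈ Finset.range (j + 1), |τ| ^ j / j.factorial * powChebCoeff j m * R ^ m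
          ≤ ∑ m ∈ Finset.range (j + 1), |τ| ^ j / j.factorial * 1 * R ^ j := by
            refine Finset.sum_le_sum fun m hm => ?_
            have hm' : m ≤ j := by have := Finset.mem_range.1 hm; omega
            have h1 := pow_le_pow_right₀ hR hm'
            have h2 := powChebCoeff_le_one j m
            gcongr
        _ = (j + 1 : ℝ) * (|τ| ^ j / j.factorial * R ^ j) := by
            rw [Finset.sum_const, Finset.card_range, nsmul_eq_mul]; push_cast; ring
        _ ≤ 2 ^ j * (|τ| ^ j / j.factorial * R ^ j) := by
            gcongr
            exact_mod_cast Nat.lt_two_pow_self (n := j)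
        _ = _ := by rw [mul_pow, mul_pow]; ring

namespace HomTree

variable {Q : ℕ} (T : HomTree Q)

lemma two_nadj_mul_chebOp_zero : (2 : ℂ) • (T.nadj * T.chebOp 0) = T.chebOp 1 := by
  simp only [chebOp, mul_one]

lemma two_nadj_mul_chebOp_succ (m : ℕ) :
    (2 : ℂ) • (T.nadj * T.chebOp (m + 1)) = T.chebOp (m + 2) + T.chebOp m := by
  simp only [chebOp, sub_add_cancel]

lemma nadj_pow (j N : ℕ) (h : j < N) :
    T.nadj ^ j = ∑ m ∈ Finset.range N, (powChebCoeff j m : ℂ) • T.chebOp m := by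
  induction j generalizing N with
  | zero =>
    obtain ⟨N, rfl⟩ : ∃ K, N = K + 1 := ⟨N - 1, by omega⟩
    rw [Finset.sum_range_succ']
    simp [powChebCoeff, chebOp]
  | succ j ih =>
    obtain ⟨N, rfl⟩ : ∃ K, N = K + 1 := ⟨N - 1, by omega⟩
    have h2 : (2 : ℂ) ≠ 0 := two_ne_zero
    have hN0 : powChebCoeff j N = 0 := powChebCoeff_eq_zero (by omega)
    have hN1 : powChebCoeff j (N + 1) = 0 := powChebCoeff_eq_zero (by omega)
    refine smul_right_injective _ h2 ?_
    simp only
    set a : ℕ → ℂ := fun m => (powChebCoeff j m : ℂ) with ha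
    have l1 : (2 : ℂ) • T.nadj ^ (j + 1) =
        a 0 • T.chebOp 1 + ∑ m ∈ Finset.range N, a (m + 1) • (T.chebOp (m + 2) + T.chebOp m) := by
      rw [pow_succ', ih (N + 1) (by omega), Finset.mul_sum, Finset.smul_sum,
        Finset.sum_range_succ', add_comm]
      simp only [mul_smul_comm, smul_comm (2 : ℂ), two_nadj_mul_chebOp_zero,
        two_nadj_mul_chebOp_succ, ha]
    have l2 : (2 : ℂ) • ∑ m ∈ Finset.range (N + 1), (powChebCoeff (j + 1) m : ℂ) • T.chebOp m =
        a 1 • T.chebOp 0 + ∑ m ∈ Finset.range N, (a (m + 2) + a m) • T.chebOp (m + 1) := by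
      rw [Finset.smul_sum, Finset.sum_range_succ', add_comm]
      simp only [smul_smul, powChebCoeff, ha]
      push_cast
      congr 1
      · congr 1; ring
      · refine Finset.sum_congr rfl fun m _ => ?_
        congr 1; ring
    have l3 : a 0 • T.chebOp 1 + ∑ m ∈ Finset.range N, a (m + 1) • T.chebOp (m + 2) =
        ∑ m ∈ Finset.range N, a m • T.chebOp (m + 1) := by
      have := Finset.sum_range_succ (fun m => a m • T.chebOp (m + 1)) N
      rw [Finset.sum_range_succ', ha] at this
      simp only [hN0, Complex.ofReal_zero, zero_smul, add_zero] at this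
      rw [add_comm]
      exact this
    have l4 : a 1 • T.chebOp 0 + ∑ m ∈ Finset.range N, a (m + 2) • T.chebOp (m + 1) =
        ∑ m ∈ Finset.range N, a (m + 1) • T.chebOp m := by
      have := Finset.sum_range_succ (fun m => a (m + 1) • T.chebOp m) N
      rw [Finset.sum_range_succ', ha] at this
      simp only [hN1, Complex.ofReal_zero, zero_smul, add_zero] at this
      rw [add_comm]
      exact this
    rw [l1, l2]
    simp only [smul_add, add_smul, Finset.sum_add_distrib]
    rw [← add_assoc, l3, ← l4]
    abel

end HomTree

/-- Chebyshev expansion of `exp (-iτB)` in a Banach algebra. -/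
lemma hasSum_expChebCoeff_smul {𝔸 : Type*} [NormedRing 𝔸] [NormedAlgebra ℂ 𝔸] [CompleteSpace 𝔸]
    {B : 𝔸} {U : ℕ → 𝔸} {R : ℝ} (hR : 1 ≤ R) (hU : ∀ m, ‖U m‖ ≤ R ^ m)
    (hpow : ∀ j N, j < N → B ^ j = ∑ m ∈ Finset.range N, (powChebCoeff j m : ℂ) • U m) (τ : ℝ) :
    HasSum (fun m => expChebCoeff τ m • U m) (NormedSpace.exp ((-I * τ : ℂ) • B)) := by
  let f : ℕ × ℕ → 𝔸 := fun z =>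
    ((z.1.factorial : ℂ)⁻¹ * (-I * τ) ^ z.1 * powChebCoeff z.1 z.2) • U z.2
  have hf : f = fun z => ((z.1.factorial : ℂ)⁻¹ * (-I * τ) ^ z.1 * powChebCoeff z.1 z.2) • U z.2 := rfl
  clear_value f
  have hsf : Summable f := by
    refine Summable.of_norm_bounded (summable_powChebCoeff_mul τ hR) fun z => ?_
    rw [hf, norm_smul]
    refine mul_le_mul ?_ (hU _) (norm_nonneg _)
      (mul_nonneg (by positivity) (powChebCoeff_nonneg _ _))
    simp only [norm_mul, norm_inv, norm_pow, norm_neg, norm_I, one_mul, Complex.norm_real,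
        Complex.norm_natCast, Real.norm_eq_abs, abs_of_nonneg (powChebCoeff_nonneg _ _)]
    rw [div_eq_mul_inv, mul_comm (|τ| ^ z.1)]
  have hrow (j : ℕ) : HasSum (fun m => f (j, m))
      ((j.factorial : ℂ)⁻¹ • ((-I * τ : ℂ) • B) ^ j) := by
    have : (j.factorial : ℂ)⁻¹ • ((-I * τ : ℂ) • B) ^ j =
        ∑ m ∈ Finset.range (j + 1), f (j, m) := by
      rw [smul_pow, hpow j (j + 1) (by omega), Finset.smul_sum, Finset.smul_sum]
      simp only [hf, smul_smul, mul_assoc]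
    rw [this]
    refine hasSum_sum_of_ne_finset_zero fun m hm => ?_
    rw [Finset.mem_range] at hm
    simp only [hf]
    rw [powChebCoeff_eq_zero (by omega)]; simp
  have hexp := NormedSpace.exp_series_hasSum_exp' (𝕂 := ℂ) ((-I * τ : ℂ) • B)
  have htot : HasSum f (NormedSpace.exp ((-I * τ : ℂ) • B)) := by
    have := hsf.hasSum.prod_fiberwise hrow
    rw [← this.unique hexp]
    exact hsf.hasSum
  have hswap : HasSum (fun z : ℕ × ℕ => f z.swap) (NormedSpace.exp ((-I * τ : ℂ) • B)) :=
    (Equiv.prodComm ℕ ℕ).hasSum_iff.2 htot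
  refine hswap.prod_fiberwise fun m => ?_
  rw [hf]
  exact (hasSum_expChebCoeff τ m).smul_const _

lemma summable_norm_expChebCoeff_mul_pow (τ : ℝ) {R : ℝ} (hR : 1 ≤ R) :
    Summable fun m => ‖expChebCoeff τ m‖ * R ^ m := by
  have hs := (summable_powChebCoeff_mul τ hR).prod_symm
  refine Summable.of_nonneg_of_le (fun m => by positivity) (fun m => ?_) hs.prod
  have h1 := (hasSum_expChebCoeff τ m).mul_right ((R : ℂ) ^ m)
  have h2 : ‖expChebCoeff τ m * (R : ℂ) ^ m‖ ≤
      ∑' j : ℕ, |τ| ^ j / j.factorial * powChebCoeff j m * R ^ m := by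
    rw [← h1.tsum_eq]
    refine tsum_of_norm_bounded (hs.prod_factor m).hasSum fun j => ?_
    simp only [norm_mul, norm_inv, norm_pow, norm_neg, norm_I, one_mul, Complex.norm_real,
        Complex.norm_natCast, Real.norm_eq_abs, abs_of_nonneg (powChebCoeff_nonneg _ _),
        Prod.swap, abs_of_nonneg (zero_le_one.trans hR)]
    rw [div_eq_mul_inv, mul_comm (|τ| ^ j)]
  rwa [norm_mul, norm_pow, Complex.norm_real, Real.norm_of_nonneg (zero_le_one.trans hR)] at h2

namespace HomTree

variable {Q : ℕ} (T : HomTree Q)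

lemma hasSum_exp_nadj (τ : ℝ) :
    HasSum (fun m => expChebCoeff τ m • T.chebOp m) (NormedSpace.exp ((-I * τ : ℂ) • T.nadj)) :=
  hasSum_expChebCoeff_smul T.one_le_chebRate T.norm_chebOp_le T.nadj_pow τ

/-- The combinatorial Laplacian on `ℓ²`. -/
def lap : T.L2 →L[ℂ] T.L2 := 1 - ((Q : ℂ) + 1)⁻¹ • T.adj

/-- The Schrödinger group on `ℓ²`. -/
def flow (t : ℝ) : T.L2 →L[ℂ] T.L2 := NormedSpace.exp ((I * t : ℂ) • T.lap)

lemma flow_zero : T.flow 0 = 1 := by simp [flow]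

lemma flow_add (s t : ℝ) : T.flow (s + t) = T.flow s * T.flow t := by
  let : NormedAlgebra ℚ (T.L2 →L[ℂ] T.L2) := NormedAlgebra.restrictScalars ℚ ℂ _
  rw [flow, flow, flow, ← NormedSpace.exp_add_of_commute, ← add_smul, ← mul_add]
  · push_cast; rfl
  · exact ((Commute.refl _).smul_left _).smul_right _

lemma flow_add_apply (s t : ℝ) (g : T.L2) : T.flow (s + t) g = T.flow s (T.flow t g) := by
  rw [flow_add]; rfl

lemma flow_neg_apply_flow (t : ℝ) (g : T.L2) : T.flow (-t) (T.flow t g) = g := by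
  rw [← flow_add_apply, neg_add_cancel, flow_zero]; rfl

lemma continuous_flow : Continuous T.flow := by
  let : NormedAlgebra ℚ (T.L2 →L[ℂ] T.L2) := NormedAlgebra.restrictScalars ℚ ℂ _
  exact NormedSpace.exp_continuous.comp (by fun_prop)

lemma star_lap : star T.lap = T.lap := by
  have h : star T.adj = T.adj := by
    rw [ContinuousLinearMap.star_eq_adjoint]
    exact ((ContinuousLinearMap.eq_adjoint_iff _ _).2 T.inner_adj).symm
  rw [lap, star_sub, star_one, star_smul, h]
  simp

lemma star_flow (t : ℝ) : star (T.flow t) = T.flow (-t) := by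
  rw [flow, NormedSpace.star_exp, star_smul, star_lap, flow]
  congr 2
  simp

lemma inner_flow_left (t : ℝ) (g h : T.L2) :
    inner ℂ (T.flow t g) h = inner ℂ g (T.flow (-t) h) := by
  rw [← star_flow, ContinuousLinearMap.star_eq_adjoint, ContinuousLinearMap.adjoint_inner_right]

lemma norm_flow_apply (t : ℝ) (g : T.L2) : ‖T.flow t g‖ = ‖g‖ := by
  have h : inner ℂ (T.flow t g) (T.flow t g) = inner ℂ g g := by
    rw [inner_flow_left, flow_neg_apply_flow]
  rw [inner_self_eq_norm_sq_to_K, inner_self_eq_norm_sq_to_K] at h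
  have h2 : ‖T.flow t g‖ ^ 2 = ‖g‖ ^ 2 := by exact_mod_cast h
  exact (sq_eq_sq₀ (norm_nonneg _) (norm_nonneg _)).1 h2

lemma hasSum_flow (hQ : 2 ≤ Q) (t : ℝ) :
    HasSum (fun m => (Complex.exp (I * t) * expChebCoeff (gammaZero Q * t) m) • T.chebOp m)
      (T.flow t) := by
  have hs : (√(Q : ℝ)) ≠ 0 := by positivity
  have hs2 : √(Q : ℝ) * √Q = Q := Real.mul_self_sqrt (by positivity)
  have hγ : gammaZero Q * (2 * √Q)⁻¹ = ((Q : ℝ) + 1)⁻¹ := by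
    rw [gammaZero]
    generalize √(Q : ℝ) = s at hs hs2
    have : s * s + 1 ≠ 0 := by nlinarith [mul_self_nonneg s]
    rw [← hs2]
    field_simp
  have e : (I * t : ℂ) • T.lap = algebraMap ℂ _ (I * t) +
      (-I * (gammaZero Q * t : ℝ) : ℂ) • T.nadj := by
    rw [lap, nadj, smul_sub, smul_smul, smul_smul, Algebra.algebraMap_eq_smul_one, sub_eq_add_neg,
      ← neg_smul]
    congr 2
    have hγ' : (gammaZero Q : ℂ) * ((2 * √Q : ℝ) : ℂ)⁻¹ = ((Q : ℂ) + 1)⁻¹ := by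
      have := congr_arg (fun r : ℝ => (r : ℂ)) hγ
      push_cast at this ⊢
      exact this
    rw [← hγ']
    push_cast
    ring
  have h := (T.hasSum_exp_nadj (gammaZero Q * t)).const_smul (Complex.exp (I * t))
  simp only [smul_smul] at h
  convert h using 1
  let : NormedAlgebra ℚ (T.L2 →L[ℂ] T.L2) := NormedAlgebra.restrictScalars ℚ ℂ _
  rw [flow, e, NormedSpace.exp_add_of_commute (Algebra.commutes _ _),
    ← NormedSpace.algebraMap_exp_comm, ← Complex.exp_eq_exp_ℂ, Algebra.algebraMap_eq_smul_one,
    smul_one_mul]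

lemma schKernel_eq_tsum (hQ : 2 ≤ Q) (t : ℝ) (n : ℕ) :
    schKernel Q t n = ∑' m, Complex.exp (I * t) * expChebCoeff (gammaZero Q * t) m *
      (chebKernel Q m n : ℂ) := by
  have hQ0 : (0 : ℝ) < Q := by positivity
  have hinj : Function.Injective fun k : ℕ => n + 2 * k := fun a b h => by
    simp only at h; omega
  rw [← hinj.tsum_eq, schKernel, ← tsum_mul_left]
  · refine tsum_congr fun k => ?_
    have hk : chebKernel Q (n + 2 * k) n = (Q : ℝ) ^ (-(n : ℝ) / 2 - (k : ℝ)) := by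
      rw [chebKernel, if_pos ⟨by omega, ⟨n + k, by omega⟩⟩, Real.sqrt_eq_rpow,
        ← Real.rpow_neg hQ0.le, ← Real.rpow_natCast, ← Real.rpow_mul hQ0.le]
      congr 1; push_cast; ring
    rw [hk, expChebCoeff]
    have : (fun l : ℝ => Complex.exp (-I * (gammaZero Q) * t * Real.cos l) *
          (Real.sin l : ℂ) * (Real.sin (((n : ℝ) + 2 * k + 1) * l) : ℂ)) =
        fun l : ℝ => Complex.exp (-I * ((gammaZero Q * t : ℝ) : ℂ) * Real.cos l) *
          (Real.sin l : ℂ) * (Real.sin ((((n + 2 * k : ℕ) : ℝ) + 1) * l) : ℂ) := by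
      funext l; push_cast; simp only [mul_assoc]
    rw [this]
    ring
  · intro m hm
    rw [Function.mem_support] at hm
    by_contra hr
    refine hm ?_
    have : chebKernel Q m n = 0 := by
      rw [chebKernel, if_neg]
      rintro ⟨h1, c, hc⟩
      exact hr ⟨c - n, by simp only; omega⟩
    rw [this]; simp

lemma summable_kernel (hQ : 2 ≤ Q) (t : ℝ) (g : T.L2) (x : T.V) :
    Summable fun z : ℕ × T.V => Complex.exp (I * t) * expChebCoeff (gammaZero Q * t) z.1 *
      ((chebKernel Q z.1 (T.graph.dist x z.2) : ℂ) * g z.2) := by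
  have hmem : Memℓp (fun y => (‖g y‖ : ℂ)) 2 := by
    refine memℓp_gen ?_
    simpa using (T.hasSum_norm_sq g).summable
  set G : T.L2 := ⟨fun y => (‖g y‖ : ℂ), hmem⟩
  have hrow (m : ℕ) : HasSum (fun y => chebKernel Q m (T.graph.dist x y) * ‖g y‖)
      (T.chebOp m G x).re := by
    have h := Complex.hasSum_re (T.hasSum_chebOp hQ m G x)
    have e : ∀ y, ((chebKernel Q m (T.graph.dist x y) : ℂ) * G y).re =
        chebKernel Q m (T.graph.dist x y) * ‖g y‖ := fun y => by
      rw [Complex.re_ofReal_mul]; rfl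
    simpa only [e] using h
  have hnorm : ∀ m y, ‖Complex.exp (I * t) * expChebCoeff (gammaZero Q * t) m *
      ((chebKernel Q m (T.graph.dist x y) : ℂ) * g y)‖ = ‖expChebCoeff (gammaZero Q * t) m‖ *
      (chebKernel Q m (T.graph.dist x y) * ‖g y‖) := fun m y => by
    rw [norm_mul, norm_mul, mul_comm I, Complex.norm_exp_ofReal_mul_I, one_mul, norm_mul,
      Complex.norm_real, Real.norm_of_nonneg (chebKernel_nonneg _ _ _)]
  refine Summable.of_norm ((summable_prod_of_nonneg fun z => norm_nonneg _).2 ⟨fun m => ?_, ?_⟩)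
  · simp only [hnorm]
    exact (hrow m).summable.mul_left _
  · simp only [hnorm, tsum_mul_left, (hrow _).tsum_eq]
    refine Summable.of_nonneg_of_le (fun m => mul_nonneg (norm_nonneg _) ?_) (fun m => ?_)
      ((summable_norm_expChebCoeff_mul_pow (gammaZero Q * t) T.one_le_chebRate).mul_right ‖G‖)
    · exact (hrow m).nonneg fun y => mul_nonneg (chebKernel_nonneg _ _ _) (norm_nonneg _)
    · rw [mul_assoc]
      refine mul_le_mul_of_nonneg_left ?_ (norm_nonneg _)
      calc (T.chebOp m G x).re ≤ ‖T.chebOp m G x‖ := Complex.re_le_norm _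
        _ ≤ ‖T.chebOp m G‖ := T.norm_apply_le _ _
        _ ≤ _ := (T.chebOp m).le_of_opNorm_le (T.norm_chebOp_le m) G

/-- On `ℓ²` the Schrödinger group is convolution with the radial kernel. -/
lemma propagate_eq_flow (hQ : 2 ≤ Q) (t : ℝ) (g : T.L2) (x : T.V) :
    propagate T t g x = T.flow t g x := by
  have hsum := T.summable_kernel hQ t g x
  have h1 : HasSum (fun m => Complex.exp (I * t) * expChebCoeff (gammaZero Q * t) m *
      T.chebOp m g x) (T.flow t g x) := by
    have h := ((lp.evalCLM ℂ (fun _ : T.V => ℂ) 2 x).comp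
      (ContinuousLinearMap.apply ℂ T.L2 g)).hasSum (T.hasSum_flow hQ t)
    exact h
  have h2 : HasSum (fun z : ℕ × T.V => Complex.exp (I * t) * expChebCoeff (gammaZero Q * t) z.1 *
      ((chebKernel Q z.1 (T.graph.dist x z.2) : ℂ) * g z.2)) (T.flow t g x) := by
    have := hsum.hasSum.prod_fiberwise fun m => (T.hasSum_chebOp hQ m g x).mul_left
      (Complex.exp (I * t) * expChebCoeff (gammaZero Q * t) m)
    rw [← this.unique h1]
    exact hsum.hasSum
  have hker (y : T.V) : schKernel Q t (T.graph.dist x y) * g y =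
      ∑' m, Complex.exp (I * t) * expChebCoeff (gammaZero Q * t) m *
        ((chebKernel Q m (T.graph.dist x y) : ℂ) * g y) := by
    rw [schKernel_eq_tsum hQ, ← tsum_mul_right]
    exact tsum_congr fun m => by ring
  have hswap := (Equiv.prodComm T.V ℕ).hasSum_iff.2 h2
  have h3 : HasSum (fun y => schKernel Q t (T.graph.dist x y) * g y) (T.flow t g x) := by
    refine hswap.prod_fiberwise fun y => ?_
    rw [hker]
    exact (hswap.summable.prod_factor y).hasSum
  have h4 := h3.tsum_fiberwise fun y => T.graph.dist x y
  rw [propagate, ← h4.tsum_eq]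
  refine tsum_congr fun n => ?_
  rw [sphereSum, ← tsum_mul_left]
  refine tsum_congr fun y => ?_
  rw [show T.graph.dist x y = n from y.2]

end HomTree

namespace HomTree

/-- The constant in the weighted dispersive estimate. -/
def dispConst (Q : ℕ) (γ : ℝ) : ℝ := ∑' m : ℕ, 36 * ((m : ℝ) + 1) ^ 2 *
  (((√Q)⁻¹ ^ m) ^ ((γ - 1) / (γ + 1)) * ((m : ℝ) + 1) ^ (2 / (γ + 1)))

lemma summable_dispConst {Q : ℕ} (hQ : 2 ≤ Q) {γ : ℝ} (hγ : 1 < γ) :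
    Summable fun m : ℕ => 36 * ((m : ℝ) + 1) ^ 2 *
      (((√Q)⁻¹ ^ m) ^ ((γ - 1) / (γ + 1)) * ((m : ℝ) + 1) ^ (2 / (γ + 1))) := by
  have hs : 1 < √(Q : ℝ) := Real.lt_sqrt_of_sq_lt (by norm_num; omega)
  have hi0 : 0 < (√(Q : ℝ))⁻¹ := by positivity
  have hi1 : (√(Q : ℝ))⁻¹ < 1 := inv_lt_one_of_one_lt₀ hs
  have hθ : 0 < (γ - 1) / (γ + 1) := div_pos (by linarith) (by linarith)
  set r : ℝ := (√(Q : ℝ))⁻¹ ^ ((γ - 1) / (γ + 1)) with hr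
  have hr0 : 0 < r := Real.rpow_pos_of_pos hi0 _
  have hr1 : r < 1 := Real.rpow_lt_one hi0.le hi1 hθ
  have hb : Summable fun m : ℕ => ((m : ℝ) + 1) ^ 3 * r ^ m := by
    have h := (summable_nat_add_iff 1).2
      (summable_pow_mul_geometric_of_norm_lt_one (R := ℝ) 3 (r := r)
        (by rwa [Real.norm_of_nonneg hr0.le]))
    refine (h.mul_left r⁻¹).congr fun m => ?_
    rw [pow_succ r]
    push_cast
    field_simp
  refine Summable.of_nonneg_of_le (fun m => by positivity) (fun m => ?_) (hb.mul_left 36)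
  have e1 : ((√(Q : ℝ))⁻¹ ^ m) ^ ((γ - 1) / (γ + 1)) = r ^ m := by
    rw [hr, ← Real.rpow_natCast, ← Real.rpow_natCast, ← Real.rpow_mul hi0.le,
      ← Real.rpow_mul hi0.le, mul_comm]
  have e2 : ((m : ℝ) + 1) ^ (2 / (γ + 1)) ≤ (m : ℝ) + 1 := by
    refine (Real.rpow_le_rpow_of_exponent_le (by simp) ?_).trans_eq (Real.rpow_one _)
    rw [div_le_one (by linarith)]; linarith
  rw [e1]
  calc 36 * ((m : ℝ) + 1) ^ 2 * (r ^ m * ((m : ℝ) + 1) ^ (2 / (γ + 1)))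
      ≤ 36 * ((m : ℝ) + 1) ^ 2 * (r ^ m * ((m : ℝ) + 1)) := by gcongr
    _ = _ := by ring

/-- The decay rate of the Schrödinger group in the weighted dispersive estimate. -/
def dispDecay (Q : ℕ) (γ t : ℝ) : ℝ :=
  (1 + |gammaZero Q * t|) ^ (-(3 / 2) : ℝ) * dispConst Q γ

lemma dispConst_nonneg (Q : ℕ) (γ : ℝ) : 0 ≤ dispConst Q γ :=
  tsum_nonneg fun m => by positivity

lemma dispDecay_nonneg (Q : ℕ) (γ t : ℝ) : 0 ≤ dispDecay Q γ t :=
  mul_nonneg (by positivity) (dispConst_nonneg Q γ)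

lemma dispDecay_neg (Q : ℕ) (γ t : ℝ) : dispDecay Q γ (-t) = dispDecay Q γ t := by
  simp [dispDecay]

lemma continuous_dispDecay (Q : ℕ) (γ : ℝ) : Continuous (dispDecay Q γ) := by
  unfold dispDecay
  refine Continuous.mul (Continuous.rpow_const (by fun_prop) fun t => Or.inl ?_) continuous_const
  positivity

lemma integrable_dispDecay {Q : ℕ} (hQ : 2 ≤ Q) (γ : ℝ) : Integrable (dispDecay Q γ) := by
  have h : Integrable fun t : ℝ => (1 + ‖t‖) ^ (-(3 / 2) : ℝ) :=
    integrable_one_add_norm (by simp; norm_num)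
  have hg : gammaZero Q ≠ 0 := by
    have : 0 < √(Q : ℝ) := by positivity
    rw [gammaZero]; positivity
  exact (h.comp_mul_left' hg).mul_const _

variable {Q : ℕ} (T : HomTree Q)

/-- Weighted dispersive estimate for the Schrödinger group. -/
lemma norm_inner_flow_le (hQ : 2 ≤ Q) {γ : ℝ} (hγ : 1 < γ) {g h φ ψ : T.L2}
    (hg : ∀ x, ‖g x‖ ≤ ‖φ x‖ ^ γ) (hh : ∀ x, ‖h x‖ ≤ ‖ψ x‖ ^ γ) (t : ℝ) :
    ‖inner ℂ (T.flow t g) h‖ ≤ dispDecay Q γ t *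
      T.potential γ φ ^ (γ / (γ + 1)) * T.potential γ ψ ^ (γ / (γ + 1)) := by
  have h1 := ((innerSL ℂ h).comp (ContinuousLinearMap.apply ℂ T.L2 g)).hasSum (T.hasSum_flow hQ t)
  have h2 := ((summable_dispConst hQ hγ).hasSum.mul_left
    ((1 + |gammaZero Q * t|) ^ (-(3 / 2) : ℝ))).mul_right
      (T.potential γ φ ^ (γ / (γ + 1)) * T.potential γ ψ ^ (γ / (γ + 1)))
  rw [norm_inner_symm, mul_assoc]
  change ‖((innerSL ℂ h).comp (ContinuousLinearMap.apply ℂ T.L2 g)) (T.flow t)‖ ≤ _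
  rw [← h1.tsum_eq]
  refine tsum_of_norm_bounded h2 fun m => ?_
  change ‖inner ℂ h ((Complex.exp (I * t) * expChebCoeff (gammaZero Q * t) m) •
    T.chebOp m g)‖ ≤ _
  rw [inner_smul_right, norm_mul, norm_mul, mul_comm I, Complex.norm_exp_ofReal_mul_I, one_mul,
    norm_inner_symm]
  calc _ ≤ _ := mul_le_mul (norm_expChebCoeff_le _ m)
        (T.norm_inner_chebOp_le hQ hγ.le hg hh m) (norm_nonneg _) (by positivity)
    _ = _ := by ring

lemma norm_inner_flow_le_mul (hQ : 2 ≤ Q) {γ : ℝ} (hγ : 1 < γ) {g h φ ψ : T.L2} {C : ℝ}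
    (hC : 0 < C) (hg : ∀ x, ‖g x‖ ≤ C * ‖φ x‖ ^ γ) (hh : ∀ x, ‖h x‖ ≤ C * ‖ψ x‖ ^ γ) (t : ℝ) :
    ‖inner ℂ (T.flow t g) h‖ ≤ C ^ 2 * dispDecay Q γ t *
      T.potential γ φ ^ (γ / (γ + 1)) * T.potential γ ψ ^ (γ / (γ + 1)) := by
  have hscale {k χ : T.L2} (hk : ∀ x, ‖k x‖ ≤ C * ‖χ x‖ ^ γ) (x : T.V) :
      ‖((C⁻¹ : ℂ) • k) x‖ ≤ ‖χ x‖ ^ γ := by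
    rw [lp.coeFn_smul, Pi.smul_apply, norm_smul, norm_inv, Complex.norm_real,
      Real.norm_of_nonneg hC.le, inv_mul_le_iff₀ hC]
    exact hk x
  have h := T.norm_inner_flow_le hQ hγ (hscale hg) (hscale hh) t
  rw [map_smul, inner_smul_left, inner_smul_right, norm_mul, norm_mul, RCLike.norm_conj, norm_inv,
    Complex.norm_real, Real.norm_of_nonneg hC.le, inv_mul_le_iff₀ hC, inv_mul_le_iff₀ hC] at h
  calc _ ≤ _ := h
    _ = _ := by ring

end HomTree

lemma norm_sub_le_of_norm_le {E : Type*} [NormedAddCommGroup E] [NormedSpace ℝ E] {v g : ℝ → E} (hvg : ∀ s t, v t - v s = ∫ r in s..t, g r) {G : ℝ}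
    (hG : ∀ t, ‖g t‖ ≤ G) (s t : ℝ) : ‖v t - v s‖ ≤ G * |t - s| := by
  rw [hvg]
  exact intervalIntegral.norm_integral_le_of_norm_le_const fun r _ => hG r

section Curve

variable {E : Type*} [NormedAddCommGroup E] [InnerProductSpace ℂ E] [CompleteSpace E]

/-- The fundamental theorem of calculus can be checked on separating families of functionals. -/
lemma sub_eq_integral_of_coord {ι : Type*} {l : ℝ → ι → E →L[ℂ] ℂ}
    (hl : ∀ t z, (∀ i, l t i z = 0) → z = 0)
    {v g : ℝ → E} (hg : Continuous g)
    (h : ∀ i t, l t i (v t) - l t i (v 0) = ∫ r in (0 : ℝ)..t, l t i (g r)) (s t : ℝ) :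
    v t - v s = ∫ r in s..t, g r := by
  have h0 (t : ℝ) : v t - v 0 = ∫ r in (0 : ℝ)..t, g r := by
    refine sub_eq_zero.1 (hl t _ fun i => ?_)
    rw [map_sub, map_sub, h, sub_eq_zero]
    exact (l t i).intervalIntegral_comp_comm (hg.intervalIntegrable _ _)
  rw [← intervalIntegral.integral_interval_sub_left (hg.intervalIntegrable 0 t)
    (hg.intervalIntegrable 0 s), ← h0, ← h0]
  abel

lemma norm_eq_of_re_inner_eq_zero {v g : ℝ → E} (hg : Continuous g)
    (hvg : ∀ s t, v t - v s = ∫ r in s..t, g r) (h : ∀ t, (inner ℂ (v t) (g t)).re = 0) (t : ℝ) :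
    ‖v t‖ = ‖v 0‖ := by
  have hd (t : ℝ) : HasDerivAt v (g t) t := by
    have := ((intervalIntegral.integral_hasDerivAt_right (hg.intervalIntegrable 0 t)
      hg.stronglyMeasurable.stronglyMeasurableAtFilter hg.continuousAt).add_const (v 0))
    refine this.congr_of_eventuallyEq (Eventually.of_forall fun t => ?_)
    show v t = (∫ r in (0 : ℝ)..t, g r) + v 0
    rw [← hvg, sub_add_cancel]
  have hn (t : ℝ) : HasDerivAt (fun t => (inner ℂ (v t) (v t)).re) 0 t := by
    have h1 := Complex.reCLM.hasFDerivAt.comp_hasDerivAt t ((hd t).inner ℂ (hd t))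
    have h2 : (inner ℂ (g t) (v t)).re = 0 := by
      rw [← inner_conj_symm, Complex.conj_re, h t]
    have h3 : Complex.reCLM (inner ℂ (v t) (g t) + inner ℂ (g t) (v t)) = 0 := by
      rw [Complex.reCLM_apply, Complex.add_re, h t, h2, add_zero]
    rw [h3] at h1
    exact h1
  have hc := is_const_of_deriv_eq_zero (fun t => (hn t).differentiableAt) (fun t => (hn t).deriv) t 0
  have e (z : E) : (inner ℂ z z).re = ‖z‖ ^ 2 := (norm_sq_eq_re_inner (𝕜 := ℂ) z).symm
  simp only [e] at hc
  exact (sq_eq_sq₀ (norm_nonneg _) (norm_nonneg _)).1 hc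

/-- Two-sided version of `exists_tendsto_of_bootstrap`. -/
lemma exists_tendsto_atTop_atBot_of_bootstrap {k n Φ : ℝ → ℝ} (hk : Continuous k)
    (hk0 : ∀ t, 0 ≤ k t) (hke : ∀ t, k (-t) = k t) (hki : Integrable k) (hn : Continuous n)
    (hn0 : ∀ t, 0 ≤ n t) {v g w : ℝ → E} (hv : Continuous v) (hg : Continuous g)
    (hw : Continuous w) (hvg : ∀ s t, v t - v s = ∫ r in s..t, g r)
    (hgg : ∀ s t, ‖inner ℂ (g s) (g t)‖ ≤ k (t - s) * n s * n t)
    (hgw : ∀ s t, ‖inner ℂ (g s) (w t)‖ ≤ k (t - s) * n s * n t)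
    (hww : ∀ s t, ‖inner ℂ (w s) (w t)‖ ≤ k (t - s) * n s * n t)
    (hΦ : ∀ t, inner ℂ (v t) (w t) = (Φ t : ℂ)) {M : ℝ} (hM : ∀ t, ‖v t‖ ≤ M)
    (hsmall : ∀ ε > 0, ∀ᶠ t in cocompact ℝ, n t ^ 2 ≤ ε * Φ t) :
    (∃ vplus : E, Tendsto v atTop (𝓝 vplus)) ∧ ∃ vminus : E, Tendsto v atBot (𝓝 vminus) := by
  rw [cocompact_eq_atBot_atTop] at hsmall
  constructor
  · exact exists_tendsto_of_bootstrap hk hk0 hke hki hn hn0 hv hg hw hvg hgg hgw hww hΦ hM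
      fun ε hε => eventually_atTop.1 (eventually_sup.1 (hsmall ε hε)).2
  · have hkr (s t : ℝ) : k (-t - -s) = k (t - s) := by
      rw [← hke (t - s)]; congr 1; ring
    obtain ⟨z, hz⟩ := exists_tendsto_of_bootstrap (n := fun t => n (-t)) (Φ := fun t => Φ (-t))
      (v := fun t => v (-t)) (g := fun t => -g (-t)) (w := fun t => w (-t)) (M := M)
      hk hk0 hke hki (hn.comp continuous_neg) (fun t => hn0 _)
      (hv.comp continuous_neg) (hg.comp continuous_neg).neg (hw.comp continuous_neg)
      (fun s t => by
        rw [hvg, intervalIntegral.integral_neg, intervalIntegral.integral_comp_neg,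
          intervalIntegral.integral_symm])
      (fun s t => by simpa only [inner_neg_neg, hkr] using hgg (-s) (-t))
      (fun s t => by simpa only [inner_neg_left, norm_neg, hkr] using hgw (-s) (-t))
      (fun s t => by simpa only [hkr] using hww (-s) (-t))
      (fun t => hΦ _) (fun t => hM _) fun ε hε => by
        obtain ⟨a, ha⟩ := eventually_atBot.1 (eventually_sup.1 (hsmall ε hε)).1
        exact ⟨-a, fun t ht => ha _ (by linarith)⟩
    refine ⟨z, ?_⟩
    simpa only [Function.comp_def, neg_neg] using hz.comp tendsto_neg_atBot_atTop

end Curve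

/-- The model power nonlinearity `|z|^{γ-1} z`. -/
def powNonlin (γ : ℝ) (z : ℂ) : ℂ := ((‖z‖ ^ (γ - 1) : ℝ) : ℂ) * z

lemma norm_powNonlin {γ : ℝ} (hγ : 1 < γ) (z : ℂ) : ‖powNonlin γ z‖ = ‖z‖ ^ γ := by
  rw [powNonlin, norm_mul, Complex.norm_real, Real.norm_of_nonneg (by positivity)]
  nth_rw 2 [← Real.rpow_one ‖z‖]
  rw [← Real.rpow_add_of_nonneg (norm_nonneg _) (by linarith) zero_le_one, sub_add_cancel]

lemma mul_rpow_sub_le {γ a b : ℝ} (hγ : 1 < γ) (hb : 0 ≤ b) (hab : b ≤ a) :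
    b * (a ^ (γ - 1) - b ^ (γ - 1)) ≤ (γ - 1) * a ^ (γ - 1) * (a - b) := by
  rcases (hb.trans hab).eq_or_lt with h | ha
  · have : b = 0 := by linarith
    subst this; subst h; simp
  have hs : 0 ≤ b / a := by positivity
  have h := one_add_mul_self_le_rpow_one_add (s := b / a - 1) (by linarith) hγ.le
  rw [add_sub_cancel] at h
  have e : (b / a) ^ γ = (b / a) * (b / a) ^ (γ - 1) := by
    nth_rw 2 [← Real.rpow_one (b / a)]
    rw [← Real.rpow_add_of_nonneg hs zero_le_one (by linarith), add_sub_cancel]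
  have eb : b = a * (b / a) := by field_simp
  generalize b / a = s at *
  subst eb
  rw [Real.mul_rpow ha.le hs]
  have hp : 0 < a ^ (γ - 1) := by positivity
  have : s - s * s ^ (γ - 1) ≤ (γ - 1) * (1 - s) := by rw [← e]; linarith
  calc _ = (a * a ^ (γ - 1)) * (s - s * s ^ (γ - 1)) := by ring
    _ ≤ (a * a ^ (γ - 1)) * ((γ - 1) * (1 - s)) := by gcongr
    _ = _ := by ring

lemma powerLike_powNonlin {γ : ℝ} (hγ : 1 < γ) : PowerLike (powNonlin γ) γ := by
  have key : ∀ u v : ℂ, ‖v‖ ≤ ‖u‖ → ‖powNonlin γ u - powNonlin γ v‖ ≤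
      γ * (‖u‖ ^ (γ - 1) + ‖v‖ ^ (γ - 1)) * ‖u - v‖ := fun u v huv => by
    have e : powNonlin γ u - powNonlin γ v = ((‖u‖ ^ (γ - 1) : ℝ) : ℂ) * (u - v) +
        ((‖u‖ ^ (γ - 1) - ‖v‖ ^ (γ - 1) : ℝ) : ℂ) * v := by
      rw [powNonlin, powNonlin]; push_cast; ring
    have hm : 0 ≤ ‖u‖ ^ (γ - 1) - ‖v‖ ^ (γ - 1) :=
      sub_nonneg.2 (Real.rpow_le_rpow (norm_nonneg _) huv (by linarith))
    have h1 := mul_rpow_sub_le hγ (norm_nonneg v) huv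
    have h2 := norm_sub_norm_le u v
    have hp : 0 ≤ ‖u‖ ^ (γ - 1) := by positivity
    have hq : 0 ≤ ‖v‖ ^ (γ - 1) := by positivity
    rw [e]
    refine (norm_add_le _ _).trans ?_
    rw [norm_mul, norm_mul, Complex.norm_real, Complex.norm_real, Real.norm_of_nonneg hp,
      Real.norm_of_nonneg hm]
    have h3 : (γ - 1) * ‖u‖ ^ (γ - 1) * (‖u‖ - ‖v‖) ≤ (γ - 1) * ‖u‖ ^ (γ - 1) * ‖u - v‖ :=
      mul_le_mul_of_nonneg_left h2 (mul_nonneg (by linarith) hp)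
    have h4 : 0 ≤ γ * ‖v‖ ^ (γ - 1) * ‖u - v‖ := by positivity
    nlinarith
  refine ⟨γ, by linarith, fun u => ?_, fun u v => ?_⟩
  · rw [norm_powNonlin hγ]
    exact le_mul_of_one_le_left (by positivity) hγ.le
  · rcases le_total ‖v‖ ‖u‖ with h | h
    · exact key u v h
    · rw [norm_sub_rev, norm_sub_rev u, add_comm]
      exact key v u h

namespace HomTree

variable {Q : ℕ} {T : HomTree Q}

lemma norm_le_mul_of_forall {a b : T.L2} {c : ℝ} (hc : 0 ≤ c) (h : ∀ x, ‖a x‖ ≤ c * ‖b x‖) :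
    ‖a‖ ≤ c * ‖b‖ := by
  have h1 := T.hasSum_norm_sq a
  have h2 := (T.hasSum_norm_sq b).mul_left (c ^ 2)
  have h3 : ‖a‖ ^ 2 ≤ c ^ 2 * ‖b‖ ^ 2 := hasSum_le (fun x => by
    rw [← mul_pow]; exact pow_le_pow_left₀ (norm_nonneg _) (h x) 2) h1 h2
  rw [← mul_pow] at h3
  exact (pow_le_pow_iff_left₀ (norm_nonneg _) (by positivity) two_ne_zero).1 h3

variable {F : ℂ → ℂ} {γ : ℝ}

lemma exists_norm_powerLike_le (hγ : 1 < γ) (hF : PowerLike F γ) :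
    ∃ C : ℝ, 0 < C ∧ ∀ (g : T.L2) x, ‖F (g x)‖ ≤ C * ‖g‖ ^ (γ - 1) * ‖g x‖ := by
  obtain ⟨C, hC, h, -⟩ := hF
  refine ⟨C, hC, fun g x => (h _).trans ?_⟩
  rw [mul_assoc]
  refine mul_le_mul_of_nonneg_left ?_ hC.le
  calc ‖g x‖ ^ γ = ‖g x‖ ^ (γ - 1) * ‖g x‖ := by
        nth_rw 3 [← Real.rpow_one ‖g x‖]
        rw [← Real.rpow_add_of_nonneg (norm_nonneg _) (by linarith) zero_le_one, sub_add_cancel]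
    _ ≤ _ := mul_le_mul_of_nonneg_right (Real.rpow_le_rpow (norm_nonneg _) (T.norm_apply_le g x)
      (by linarith)) (norm_nonneg _)

lemma memℓp_powerLike (hγ : 1 < γ) (hF : PowerLike F γ) (g : T.L2) :
    Memℓp (fun x => F (g x)) 2 := by
  obtain ⟨C, hC, h⟩ := exists_norm_powerLike_le (T := T) hγ hF
  refine memℓp_gen ?_
  have hs := (T.hasSum_norm_sq g).summable.mul_left ((C * ‖g‖ ^ (γ - 1)) ^ 2)
  simp only [ENNReal.toReal_ofNat, Real.rpow_ofNat]
  refine Summable.of_nonneg_of_le (fun x => by positivity) (fun x => ?_) hs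
  rw [← mul_pow]
  exact pow_le_pow_left₀ (norm_nonneg _) (h g x) 2

/-- The superposition operator of a power-like nonlinearity on `ℓ²`. -/
def nemytskii (hγ : 1 < γ) (hF : PowerLike F γ) (g : T.L2) : T.L2 :=
  ⟨fun x => F (g x), memℓp_powerLike hγ hF g⟩

lemma nemytskii_apply (hγ : 1 < γ) (hF : PowerLike F γ) (g : T.L2) (x : T.V) :
    nemytskii hγ hF g x = F (g x) := rfl

lemma exists_norm_nemytskii_le (hγ : 1 < γ) (hF : PowerLike F γ) :
    ∃ C : ℝ, ∀ g : T.L2, ‖nemytskii hγ hF g‖ ≤ C * ‖g‖ ^ (γ - 1) * ‖g‖ := by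
  obtain ⟨C, hC, h⟩ := exists_norm_powerLike_le (T := T) hγ hF
  exact ⟨C, fun g => norm_le_mul_of_forall (by positivity) (h g)⟩

lemma continuous_nemytskii (hγ : 1 < γ) (hF : PowerLike F γ) :
    Continuous (nemytskii (T := T) hγ hF) := by
  obtain ⟨C, hC, -, h⟩ := id hF
  refine continuous_iff_continuousAt.2 fun g₀ => ?_
  refine tendsto_iff_norm_sub_tendsto_zero.2 ?_
  have hlim : Tendsto (fun g : T.L2 => C * (‖g‖ ^ (γ - 1) + ‖g₀‖ ^ (γ - 1)) * ‖g - g₀‖) (𝓝 g₀)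
      (𝓝 0) := by
    have hc : Continuous fun g : T.L2 => C * (‖g‖ ^ (γ - 1) + ‖g₀‖ ^ (γ - 1)) * ‖g - g₀‖ := by
      have : Continuous fun g : T.L2 => ‖g‖ ^ (γ - 1) :=
        continuous_norm.rpow_const fun _ => Or.inr (by linarith)
      fun_prop
    simpa using hc.tendsto g₀
  refine squeeze_zero (fun g => norm_nonneg _) (fun g => ?_) hlim
  refine norm_le_mul_of_forall (by positivity) fun x => ?_
  refine (h (g x) (g₀ x)).trans ?_
  refine mul_le_mul_of_nonneg_right ?_ (norm_nonneg _)
  have h1 (k : T.L2) : ‖k x‖ ^ (γ - 1) ≤ ‖k‖ ^ (γ - 1) :=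
    Real.rpow_le_rpow (norm_nonneg _) (T.norm_apply_le k x) (by linarith)
  exact mul_le_mul_of_nonneg_left (add_le_add (h1 g) (h1 g₀)) hC.le

lemma inner_nemytskii_powNonlin (hγ : 1 < γ) (g : T.L2) :
    inner ℂ g (nemytskii hγ (powerLike_powNonlin hγ) g) = (T.potential γ g : ℂ) := by
  rw [lp.inner_eq_tsum, potential, Complex.ofReal_tsum]
  refine tsum_congr fun x => ?_
  rw [nemytskii_apply, powNonlin, RCLike.inner_apply, mul_assoc, Complex.mul_conj,
    Complex.normSq_eq_norm_sq, ← Complex.ofReal_mul]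
  congr 1
  rw [← Real.rpow_natCast, ← Real.rpow_add_of_nonneg (norm_nonneg _) (by linarith) (by simp)]
  congr 1; push_cast; ring

lemma re_inner_nemytskii (hγ : 1 < γ) (hF : PowerLike F γ) (hgauge : GaugeInvariant F) (g : T.L2) :
    (inner ℂ g (-I • nemytskii hγ hF g)).re = 0 := by
  have h := Complex.hasSum_re (lp.hasSum_inner g (-I • nemytskii hγ hF g))
  have e : ∀ x, (inner ℂ (g x) ((-I • nemytskii hγ hF g : T.L2) x)).re = 0 := fun x => by
    rw [lp.coeFn_smul, Pi.smul_apply, nemytskii_apply, RCLike.inner_apply, smul_eq_mul, mul_assoc]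
    simpa using hgauge (g x)
  simp only [e] at h
  exact h.unique hasSum_zero

end HomTree

namespace HomTree

variable {Q : ℕ} {T : HomTree Q}

lemma spaceNorm_two (g : T.V → ℂ) : spaceNorm T 2 g = (∑' x, ‖g x‖ₑ ^ 2) ^ (1 / 2 : ℝ) := by
  simp [spaceNorm, enorm_eq_nnnorm]

lemma spaceNorm_coe (g : T.L2) : spaceNorm T 2 g = ‖g‖ₑ := by
  have h := T.hasSum_norm_sq g
  have e : ∑' x, ‖g x‖ₑ ^ 2 = ‖g‖ₑ ^ 2 := by
    rw [← ofReal_norm, ← ENNReal.ofReal_pow (norm_nonneg _), ← h.tsum_eq,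
      ENNReal.ofReal_tsum_of_nonneg (fun x => by positivity) h.summable]
    refine tsum_congr fun x => ?_
    rw [ENNReal.ofReal_pow (norm_nonneg _), ofReal_norm]
  rw [spaceNorm_two, e, ← ENNReal.rpow_natCast, ← ENNReal.rpow_mul]
  simp

lemma memℓp_of_spaceNorm_lt_top {g : T.V → ℂ} (hg : spaceNorm T 2 g < ∞) : Memℓp g 2 := by
  rw [spaceNorm_two, ENNReal.rpow_lt_top_iff_of_pos (by norm_num)] at hg
  refine memℓp_gen ?_
  simp only [ENNReal.toReal_ofNat, Real.rpow_ofNat]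
  have := ENNReal.summable_toReal hg.ne
  simpa using this

lemma enorm_apply_le_spaceNorm {q : ℝ} (hq : 0 < q) (g : T.V → ℂ) (x : T.V) :
    ‖g x‖ₑ ≤ spaceNorm T (ENNReal.ofReal q) g := by
  rw [spaceNorm, if_neg ENNReal.ofReal_ne_top, ENNReal.toReal_ofReal hq.le, one_div,
    ENNReal.le_rpow_inv_iff hq]
  exact ENNReal.le_tsum (f := fun x => (‖g x‖₊ : ℝ≥0∞) ^ q) x

lemma lintegral_lt_top_of_mixedNorm {p : ℝ} (hp : 0 < p) {q : ℝ≥0∞} {u : ℝ → T.V → ℂ}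
    (h : mixedNorm T (ENNReal.ofReal p) q Set.univ u < ∞) :
    ∫⁻ t, (spaceNorm T q (u t)) ^ p < ∞ := by
  rw [mixedNorm, if_neg ENNReal.ofReal_ne_top, ENNReal.toReal_ofReal hp.le,
    ENNReal.rpow_lt_top_iff_of_pos (by positivity), Measure.restrict_univ] at h
  exact h

/-- A uniformly continuous curve in `ℓ²` with finite `L^p_t ℓ^q_x` norm decays uniformly. -/
lemma eventually_norm_apply_le {U : ℝ → T.L2} (hU : UniformContinuous U) {p q : ℝ} (hp : 0 < p)
    (hq : 0 < q) (hfin : ∫⁻ t, (spaceNorm T (ENNReal.ofReal q) (U t)) ^ p < ∞) {ε : ℝ}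
    (hε : 0 < ε) : ∀ᶠ t in cocompact ℝ, ∀ x, ‖U t x‖ ≤ ε := by
  set S : Set ℝ := ⋃ x, {t | ε / 2 < ‖U t x‖} with hS
  have hSo : IsOpen S := isOpen_iUnion fun x => isOpen_lt continuous_const
    (((lp.evalCLM ℂ (fun _ : T.V => ℂ) 2 x).continuous.comp hU.continuous).norm)
  have hSfin : volume S < ∞ := by
    have h1 : ENNReal.ofReal (ε / 2) ^ p * volume S ≤
        ∫⁻ t, (spaceNorm T (ENNReal.ofReal q) (U t)) ^ p := by
      rw [← setLIntegral_const, ← lintegral_indicator hSo.measurableSet]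
      refine lintegral_mono (Set.indicator_le fun t ht => ?_)
      obtain ⟨x, hx⟩ := Set.mem_iUnion.1 ht
      refine ENNReal.rpow_le_rpow (le_trans ?_ (enorm_apply_le_spaceNorm hq _ x)) hp.le
      rw [← ofReal_norm]
      exact ENNReal.ofReal_le_ofReal (le_of_lt hx)
    refine (ENNReal.mul_lt_top_iff.1 (h1.trans_lt hfin)).elim (fun h => h.2) ?_
    rintro (h | h)
    · rw [ENNReal.rpow_eq_zero_iff_of_pos hp, ENNReal.ofReal_eq_zero] at h
      linarith
    · rw [h]; exact ENNReal.zero_lt_top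
  obtain ⟨δ, hδ, hδU⟩ := Metric.uniformContinuous_iff.1 hU (ε / 2) (by positivity)
  have : IsFiniteMeasure (volume.restrict S) := ⟨by rwa [Measure.restrict_apply_univ]⟩
  obtain ⟨K, hK, hKδ⟩ := isTightMeasureSet_iff_exists_isCompact_measure_compl_le.1
    (isTightMeasureSet_singleton (μ := volume.restrict S)) (ENNReal.ofReal δ) (by simpa)
  have hKδ := hKδ _ rfl
  filter_upwards [(hK.cthickening (r := δ)).compl_mem_cocompact] with t ht
  by_contra! hx
  obtain ⟨x, hx⟩ := hx
  have hball : Metric.ball t δ ⊆ S := fun s hs => by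
    refine Set.mem_iUnion.2 ⟨x, ?_⟩
    have h1 := hδU (Metric.mem_ball.1 hs)
    rw [dist_eq_norm] at h1
    have h2 := T.norm_apply_le (U s - U t) x
    rw [lp.coeFn_sub, Pi.sub_apply] at h2
    have h3 := norm_sub_norm_le (U t x) (U s x)
    rw [norm_sub_rev] at h3
    show ε / 2 < ‖U s x‖
    linarith
  have hballK : Metric.ball t δ ⊆ Kᶜ := fun s hs hsK =>
    ht (Metric.mem_cthickening_of_dist_le t s δ K hsK (Metric.mem_ball'.1 hs).le)
  have h1 : volume (Metric.ball t δ) ≤ ENNReal.ofReal δ := by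
    calc volume (Metric.ball t δ) = volume.restrict S (Metric.ball t δ) := by
          rw [Measure.restrict_apply Metric.isOpen_ball.measurableSet,
            Set.inter_eq_left.2 hball]
      _ ≤ _ := (measure_mono hballK).trans hKδ
  rw [Real.volume_ball, ENNReal.ofReal_le_ofReal_iff hδ.le] at h1
  linarith

lemma uniformContinuous_flow_apply {v : ℝ → T.L2} {M G : ℝ} (hM : ∀ t, ‖v t‖ ≤ M)
    (hG : ∀ s t, ‖v t - v s‖ ≤ G * |t - s|) : UniformContinuous fun t => T.flow t (v t) := by
  have hlim : Tendsto (fun r : ℝ => ‖T.flow r - 1‖ * M + G * |r|) (𝓝 0) (𝓝 0) := by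
    have hc : Continuous fun r : ℝ => ‖T.flow r - 1‖ * M + G * |r| := by
      have := T.continuous_flow
      fun_prop
    simpa [flow_zero] using hc.tendsto 0
  have hkey (s t : ℝ) : dist (T.flow t (v t)) (T.flow s (v s)) ≤
      ‖T.flow (t - s) - 1‖ * M + G * |t - s| := by
    have e : T.flow t (v t) - T.flow s (v s) =
        T.flow s ((T.flow (t - s) - 1) (v t) + (v t - v s)) := by
      rw [sub_apply, one_apply_eq_self, sub_add_sub_cancel,
        map_sub, ← flow_add_apply, add_sub_cancel]
    rw [dist_eq_norm, e, norm_flow_apply]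
    exact (norm_add_le _ _).trans (add_le_add
      (((T.flow (t - s) - 1).le_opNorm _).trans
        (mul_le_mul_of_nonneg_left (hM t) (norm_nonneg _))) (hG s t))
  refine Metric.uniformContinuous_iff.2 fun ε hε => ?_
  obtain ⟨δ, hδ, h⟩ := Metric.eventually_nhds_iff.1 (hlim.eventually (gt_mem_nhds hε))
  refine ⟨δ, hδ, fun {t s} hts => (hkey s t).trans_lt (h ?_)⟩
  rwa [dist_zero_right, ← dist_eq_norm]

end HomTree

namespace HomTree

variable {Q : ℕ} {T : HomTree Q}

lemma flow_apply_flow_neg (t : ℝ) (g : T.L2) : T.flow t (T.flow (-t) g) = g := by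
  simpa using T.flow_neg_apply_flow (-t) g

lemma inner_flow_neg_flow_neg (s t : ℝ) (g h : T.L2) :
    inner ℂ (T.flow (-s) g) (T.flow (-t) h) = inner ℂ (T.flow (t - s) g) h := by
  rw [sub_eq_add_neg, flow_add_apply, T.inner_flow_left t]

/-- The profile `e^{-itℒ} u(t)` of a solution of finite space-time norm has limits at `±∞`. -/
lemma exists_tendsto_flow_neg (hQ : 2 ≤ Q) {γ : ℝ} (hγ : 1 < γ) {F : ℂ → ℂ} (hF : PowerLike F γ)
    (hgauge : GaugeInvariant F) {p q : ℝ} (hp : 0 < p) (hq : 0 < q) {f : T.L2} {U : ℝ → T.L2}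
    (hU : Continuous U)
    (hduh : ∀ t x, U t x = T.flow t f x -
      I * ∫ s in (0 : ℝ)..t, T.flow (t - s) (nemytskii hγ hF (U s)) x)
    (hfin : ∫⁻ t, (spaceNorm T (ENNReal.ofReal q) (U t)) ^ p < ∞) :
    (∃ z : T.L2, Tendsto (fun t => T.flow (-t) (U t)) atTop (𝓝 z)) ∧
      ∃ z : T.L2, Tendsto (fun t => T.flow (-t) (U t)) atBot (𝓝 z) := by
  have hflow {a : ℝ → T.L2} (ha : Continuous a) : Continuous fun t => T.flow (-t) (a t) :=
    (T.continuous_flow.comp continuous_neg).clm_apply ha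
  have hw0 := powerLike_powNonlin hγ
  have hN := (continuous_nemytskii (T := T) hγ hF).comp hU
  have hW := (continuous_nemytskii (T := T) hγ hw0).comp hU
  set v : ℝ → T.L2 := fun t => T.flow (-t) (U t) with hvdef
  set g : ℝ → T.L2 := fun t => T.flow (-t) (-I • nemytskii hγ hF (U t)) with hgdef
  set w : ℝ → T.L2 := fun t => T.flow (-t) (nemytskii hγ hw0 (U t)) with hwdef
  have hv : Continuous v := hflow hU
  have hg : Continuous g := hflow (hN.const_smul (-I))
  have hw : Continuous w := hflow hW
  have hv0 : v 0 = f := by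
    refine lp.ext (funext fun x => ?_)
    have := hduh 0 x
    simpa [hvdef, flow_zero] using this
  have hvg : ∀ s t, v t - v s = ∫ r in s..t, g r := by
    refine sub_eq_integral_of_coord
      (l := fun t x => (lp.evalCLM ℂ (fun _ : T.V => ℂ) 2 x).comp (T.flow t))
      (fun t z hz => ?_) hg fun x t => ?_
    · have : T.flow t z = 0 := lp.ext (funext hz)
      rw [← norm_eq_zero, ← T.norm_flow_apply t, this, norm_zero]
    · change T.flow t (T.flow (-t) (U t)) x - T.flow t (v 0) x =
        ∫ r in (0 : ℝ)..t, T.flow t (g r) x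
      have e (r : ℝ) : T.flow t (g r) x =
          -I * T.flow (t - r) (nemytskii hγ hF (U r)) x := by
        have h : T.flow t (g r) = -I • T.flow (t - r) (nemytskii hγ hF (U r)) := by
          simp only [hgdef]
          rw [sub_eq_add_neg, flow_add_apply, map_smul, map_smul]
        rw [h]
        rfl
      simp only [e]
      rw [flow_apply_flow_neg, hv0, hduh, intervalIntegral.integral_const_mul]
      ring
  have hnorm (t : ℝ) : ‖v t‖ = ‖f‖ := by
    rw [← hv0]
    refine norm_eq_of_re_inner_eq_zero hg hvg (fun t => ?_) t
    rw [hvdef, hgdef, inner_flow_neg_flow_neg, sub_self, flow_zero]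
    exact re_inner_nemytskii hγ hF hgauge (U t)
  have hUnorm (t : ℝ) : ‖U t‖ = ‖f‖ := by
    rw [← hnorm t]; exact (T.norm_flow_apply _ _).symm
  obtain ⟨B, hB⟩ := exists_norm_nemytskii_le (T := T) hγ hF
  have hgB (t : ℝ) : ‖g t‖ ≤ B * ‖f‖ ^ (γ - 1) * ‖f‖ := by
    rw [hgdef, norm_flow_apply, norm_smul, norm_neg, norm_I, one_mul, ← hUnorm t]
    exact hB _
  have hunif : UniformContinuous U := by
    have := uniformContinuous_flow_apply (fun t => (hnorm t).le) (norm_sub_le_of_norm_le hvg hgB)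
    simpa only [hvdef, flow_apply_flow_neg] using this
  obtain ⟨C₀, hC₀, hFC, -⟩ := id hF
  set C := max C₀ 1
  have hC : 0 < C := lt_max_of_lt_left hC₀
  have hgle (t : ℝ) (x : T.V) : ‖(-I • nemytskii hγ hF (U t) : T.L2) x‖ ≤ C * ‖U t x‖ ^ γ := by
    rw [lp.coeFn_smul, Pi.smul_apply, norm_smul, norm_neg, norm_I, one_mul]
    exact (hFC _).trans (mul_le_mul_of_nonneg_right (le_max_left _ _) (by positivity))
  have hwle (t : ℝ) (x : T.V) : ‖nemytskii hγ hw0 (U t) x‖ ≤ C * ‖U t x‖ ^ γ := by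
    rw [nemytskii_apply, norm_powNonlin hγ]
    exact le_mul_of_one_le_left (by positivity) (le_max_right _ _)
  have hpot : Continuous fun t => T.potential γ (U t) := by
    have e (t : ℝ) : T.potential γ (U t) = (inner ℂ (U t) (nemytskii hγ hw0 (U t))).re := by
      rw [inner_nemytskii_powNonlin, Complex.ofReal_re]
    simp only [e]
    exact Complex.continuous_re.comp (hU.inner hW)
  have hγ1 : 0 < γ + 1 := by linarith
  refine exists_tendsto_atTop_atBot_of_bootstrap (k := fun t => C ^ 2 * dispDecay Q γ t)
    (n := fun t => T.potential γ (U t) ^ (γ / (γ + 1))) (Φ := fun t => T.potential γ (U t))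
    (g := g) (w := w) (M := ‖f‖)
    (continuous_const.mul (continuous_dispDecay Q γ))
    (fun t => mul_nonneg (by positivity) (dispDecay_nonneg Q γ t))
    (fun t => by rw [dispDecay_neg]) ((integrable_dispDecay hQ γ).const_mul _)
    (hpot.rpow_const fun t => Or.inr (by positivity))
    (fun t => Real.rpow_nonneg (T.potential_nonneg γ _) _) hv hg hw hvg
    (fun s t => ?_) (fun s t => ?_) (fun s t => ?_) (fun t => ?_) (fun t => (hnorm t).le)
    fun ε hε => ?_
  · rw [hgdef, inner_flow_neg_flow_neg]
    exact T.norm_inner_flow_le_mul hQ hγ hC (hgle s) (hgle t) _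
  · rw [hgdef, hwdef, inner_flow_neg_flow_neg]
    exact T.norm_inner_flow_le_mul hQ hγ hC (hgle s) (hwle t) _
  · rw [hwdef, inner_flow_neg_flow_neg]
    exact T.norm_inner_flow_le_mul hQ hγ hC (hwle s) (hwle t) _
  · rw [hvdef, hwdef, inner_flow_neg_flow_neg, sub_self, flow_zero]
    exact inner_nemytskii_powNonlin hγ (U t)
  · have hθ : 0 < (γ - 1) / (γ + 1) := div_pos (by linarith) hγ1
    have hlim : Tendsto (fun S : ℝ => (S ^ (γ - 1) * ‖f‖ ^ 2) ^ ((γ - 1) / (γ + 1))) (𝓝[>] 0)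
        (𝓝 0) := by
      have hc : Continuous fun S : ℝ => (S ^ (γ - 1) * ‖f‖ ^ 2) ^ ((γ - 1) / (γ + 1)) :=
        ((continuous_id.rpow_const fun _ => Or.inr (by linarith)).mul continuous_const).rpow_const
          fun _ => Or.inr hθ.le
      have := hc.tendsto 0
      rw [Real.zero_rpow (by linarith), zero_mul, Real.zero_rpow hθ.ne'] at this
      exact this.mono_left nhdsWithin_le_nhds
    obtain ⟨S, hSε, hS⟩ := ((hlim.eventually (gt_mem_nhds hε)).and self_mem_nhdsWithin).exists
    filter_upwards [eventually_norm_apply_le hunif hp hq hfin hS] with t ht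
    have hP := T.potential_le hγ.le (U t) ht
    rw [hUnorm] at hP
    have hP0 := T.potential_nonneg γ (U t)
    have e : (T.potential γ (U t) ^ (γ / (γ + 1))) ^ 2 =
        T.potential γ (U t) ^ ((γ - 1) / (γ + 1)) * T.potential γ (U t) := by
      nth_rw 3 [← Real.rpow_one (T.potential γ (U t))]
      rw [← Real.rpow_natCast, ← Real.rpow_mul hP0, ← Real.rpow_add_of_nonneg hP0 hθ.le zero_le_one]
      congr 1
      field_simp
      push_cast
      ring
    rw [e]
    exact mul_le_mul_of_nonneg_right ((Real.rpow_le_rpow hP0 hP hθ.le).trans hSε.le) hP0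

end HomTree

/-- Scattering: under gauge invariance, the global solution
`u ∈ C(ℝ; L²(𝕋)) ∩ L^p(ℝ; L^q(𝕋))` of the NLS with data `f ∈ L²(𝕋)` scatters to
linear solutions: there exist `u₊, u₋ ∈ L²(𝕋)` with
`‖u(t) - e^{itℒ}u_±‖_{L²} → 0` as `t → ±∞`. -/
theorem scattering (Q : ℕ) (hQ : 2 ≤ Q) (T : HomTree Q)
    (γ : ℝ) (hγ : 1 < γ) (F : ℂ → ℂ) (hF : PowerLike F γ)
    (hgauge : GaugeInvariant F)
    (p q : ℝ) (hp : 2 < p) (hq : 2 < q)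
    (f : T.V → ℂ) (hf : spaceNorm T 2 f < ∞)
    (u : ℝ → T.V → ℂ)
    (hu : SolvesNLS T F f u Set.univ) (hucont : ContL2On T u Set.univ)
    (humem : ∀ t : ℝ, spaceNorm T 2 (u t) < ∞)
    (hupq : mixedNorm T (ENNReal.ofReal p) (ENNReal.ofReal q) Set.univ u < ∞) :
    ∃ uplus uminus : T.V → ℂ,
      spaceNorm T 2 uplus < ∞ ∧ spaceNorm T 2 uminus < ∞ ∧
      Filter.Tendsto
        (fun t => spaceNorm T 2 (fun x => u t x - propagate T t uplus x))
        Filter.atTop (nhds 0) ∧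
      Filter.Tendsto
        (fun t => spaceNorm T 2 (fun x => u t x - propagate T t uminus x))
        Filter.atBot (nhds 0) := by
  let U : ℝ → T.L2 := fun t => ⟨u t, HomTree.memℓp_of_spaceNorm_lt_top (humem t)⟩
  let f₀ : T.L2 := ⟨f, HomTree.memℓp_of_spaceNorm_lt_top hf⟩
  have hUc : Continuous U := by
    refine continuous_iff_continuousAt.2 fun t₀ => tendsto_iff_edist_tendsto_0.2 ?_
    have h := hucont t₀ (Set.mem_univ _)
    rw [nhdsWithin_univ] at h
    refine h.congr fun t => ?_
    rw [edist_eq_enorm_sub, ← HomTree.spaceNorm_coe]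
    rfl
  have hduh (t : ℝ) (x : T.V) : U t x = T.flow t f₀ x -
      I * ∫ s in (0 : ℝ)..t, T.flow (t - s) (HomTree.nemytskii hγ hF (U s)) x := by
    have h := hu t (Set.mem_univ _) x
    have e (s : ℝ) : propagate T (t - s) (fun y => F (u s y)) x =
        T.flow (t - s) (HomTree.nemytskii hγ hF (U s)) x :=
      T.propagate_eq_flow hQ (t - s) (HomTree.nemytskii hγ hF (U s)) x
    simp only [e] at h
    rw [← T.propagate_eq_flow hQ]
    exact h
  obtain ⟨⟨a, ha⟩, ⟨b, hb⟩⟩ := HomTree.exists_tendsto_flow_neg hQ hγ hF hgauge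
    (zero_lt_two.trans hp) (zero_lt_two.trans hq) hUc hduh
    (HomTree.lintegral_lt_top_of_mixedNorm (zero_lt_two.trans hp) hupq)
  have hlim {l : Filter ℝ} {z : T.L2} (hz : Tendsto (fun t => T.flow (-t) (U t)) l (𝓝 z)) :
      Tendsto (fun t => spaceNorm T 2 (fun x => u t x - propagate T t z x)) l (𝓝 0) := by
    refine (tendsto_iff_edist_tendsto_0.1 hz).congr fun t => ?_
    simp only [T.propagate_eq_flow hQ]
    change _ = spaceNorm T 2 (U t - T.flow t z : T.L2)
    rw [HomTree.spaceNorm_coe, edist_eq_enorm_sub, enorm_eq_iff_norm_eq,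
      ← T.norm_flow_apply (-t) (U t - T.flow t z), map_sub, T.flow_neg_apply_flow]
  exact ⟨a, b, by rw [HomTree.spaceNorm_coe]; exact enorm_lt_top,
    by rw [HomTree.spaceNorm_coe]; exact enorm_lt_top, hlim ha, hlim hb⟩
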